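/- arXiv:1810.00963 — 6 statements merged into one kernel-verified Lean document; each statement's English description precedes it below -/
import Mathlib

section
/- Let 1 ≤ p < q < ∞ and d ≥ 1. Then the von Neumann–Jordan constant of the Morrey space M^p_q(ℝ^d) equals 2; that is, sup{ (‖f+g‖²_{M^p_q} + ‖f−g‖²_{M^p_q}) / (2(‖f‖²_{M^p_q} + ‖g‖²_{M^p_q})) : f, g ∈ M^p_q(ℝ^d), f ≠ 0, g ≠ 0 } = 2. -/
open MeasureTheory
open scoped ENNReal

/-- The Morrey norm `‖f‖_{M^p_q}` of a (measurable) function on `ℝ^d`: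
the supremum over all balls `B = B(a,r)` of `|B|^(1/q - 1/p) (∫_B |f|^p)^(1/p)`. -/
noncomputable def morreyNorm (p q : ℝ) (d : ℕ) (f : EuclideanSpace ℝ (Fin d) → ℝ) : ℝ≥0∞ :=
  ⨆ (a : EuclideanSpace ℝ (Fin d)) (r : ℝ) (_ : 0 < r),
    volume (Metric.ball a r) ^ ((1:ℝ)/q - 1/p) *
      (∫⁻ y in Metric.ball a r, ENNReal.ofReal (|f y| ^ p)) ^ ((1:ℝ)/p)

theorem ENNReal.add_sq_le_two_mul (a b : ℝ≥0∞) : (a + b) ^ 2 ≤ 2 * (a ^ 2 + b ^ 2) := by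
  have h := ENNReal.rpow_add_le_mul_rpow_add_rpow a b (p := 2) one_le_two
  norm_num at h
  exact h

theorem ENNReal.rpow_le_rpow_of_nonpos {a b : ℝ≥0∞} {z : ℝ} (hab : a ≤ b) (hz : z ≤ 0) :
    b ^ z ≤ a ^ z := by
  rw [← neg_neg z, ENNReal.rpow_neg, ENNReal.rpow_neg a]
  exact ENNReal.inv_le_inv.2 (ENNReal.rpow_le_rpow hab (neg_nonneg.2 hz))

/-- The Morrey norm dominates its local term on each ball. -/
theorem le_morreyNorm (p q : ℝ) (d : ℕ) (f : EuclideanSpace ℝ (Fin d) → ℝ)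
    (a : EuclideanSpace ℝ (Fin d)) {r : ℝ} (hr : 0 < r) :
    volume (Metric.ball a r) ^ ((1:ℝ)/q - 1/p) *
      (∫⁻ y in Metric.ball a r, ENNReal.ofReal (|f y| ^ p)) ^ ((1:ℝ)/p) ≤ morreyNorm p q d f :=
  le_iSup_of_le a <| le_iSup_of_le r <| le_iSup_of_le hr le_rfl

theorem morreyNorm_neg (p q : ℝ) (d : ℕ) (f : EuclideanSpace ℝ (Fin d) → ℝ) :
    morreyNorm p q d (-f) = morreyNorm p q d f := by
  simp [morreyNorm]

theorem morreyNorm_add_le {p : ℝ} (q : ℝ) {d : ℕ} (hp : 1 ≤ p)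
    {f g : EuclideanSpace ℝ (Fin d) → ℝ} (hf : Measurable f) (hg : Measurable g) :
    morreyNorm p q d (f + g) ≤ morreyNorm p q d f + morreyNorm p q d g := by
  have hp0 : 0 ≤ p := by linarith
  refine iSup_le fun a => iSup_le fun r => iSup_le fun hr => ?_
  refine le_trans ?_ (add_le_add (le_morreyNorm p q d f a hr) (le_morreyNorm p q d g a hr))
  rw [← mul_add]
  gcongr
  have h := ENNReal.lintegral_Lp_add_le (μ := volume.restrict (Metric.ball a r))
    (f := fun y => ENNReal.ofReal |f y|) (g := fun y => ENNReal.ofReal |g y|)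
    (by fun_prop) (by fun_prop) hp
  simp only [← ENNReal.ofReal_rpow_of_nonneg (abs_nonneg _) hp0]
  refine le_trans ?_ h
  gcongr with y
  rw [Pi.add_apply, Pi.add_apply, ← ENNReal.ofReal_add (abs_nonneg _) (abs_nonneg _)]
  exact ENNReal.ofReal_le_ofReal (abs_add_le _ _)

theorem morreyNorm_sub_le {p : ℝ} (q : ℝ) {d : ℕ} (hp : 1 ≤ p)
    {f g : EuclideanSpace ℝ (Fin d) → ℝ} (hf : Measurable f) (hg : Measurable g) :
    morreyNorm p q d (f - g) ≤ morreyNorm p q d f + morreyNorm p q d g := by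
  rw [sub_eq_add_neg, ← morreyNorm_neg p q d g]
  exact morreyNorm_add_le q hp hf hg.neg

theorem rpow_lintegral_of_abs_eq_indicator {α : Type*} [MeasurableSpace α] (μ : Measure α)
    {p c : ℝ} (hp : 0 < p) (hc : 0 ≤ c) {f : α → ℝ} {E : Set α} (hE : MeasurableSet E)
    (hf : ∀ y, |f y| = E.indicator (fun _ => c) y) :
    (∫⁻ y, ENNReal.ofReal (|f y| ^ p) ∂μ) ^ ((1:ℝ)/p) =
      ENNReal.ofReal c * μ E ^ ((1:ℝ)/p) := by
  have h : (fun y => ENNReal.ofReal (|f y| ^ p)) =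
      E.indicator fun _ => ENNReal.ofReal c ^ p := by
    ext y
    by_cases hy : y ∈ E
    · simp [hf, hy, ENNReal.ofReal_rpow_of_nonneg hc hp.le]
    · simp [hf, hy, Real.zero_rpow hp.ne']
  rw [h, lintegral_indicator_const hE, ENNReal.mul_rpow_of_nonneg _ _ (by positivity),
    ← ENNReal.rpow_mul, mul_one_div_cancel hp.ne', ENNReal.rpow_one]

theorem le_morreyNorm_of_abs_eq_indicator {p : ℝ} (q : ℝ) {d : ℕ} {c : ℝ} (hp : 0 < p)
    (hc : 0 ≤ c) {f : EuclideanSpace ℝ (Fin d) → ℝ} {E : Set (EuclideanSpace ℝ (Fin d))}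
    (hE : MeasurableSet E) (hf : ∀ y, |f y| = E.indicator (fun _ => c) y)
    {a : EuclideanSpace ℝ (Fin d)} {r : ℝ} (hr : 0 < r) (ha : Metric.ball a r ⊆ E) :
    ENNReal.ofReal c * volume (Metric.ball a r) ^ ((1:ℝ)/q) ≤ morreyNorm p q d f := by
  refine le_trans (le_of_eq ?_) (le_morreyNorm p q d f a hr)
  rw [rpow_lintegral_of_abs_eq_indicator _ hp hc hE hf, Measure.restrict_apply hE,
    Set.inter_eq_self_of_subset_right ha, mul_left_comm,
    ← ENNReal.rpow_add _ _ (Metric.measure_ball_pos volume a hr).ne' measure_ball_lt_top.ne,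
    sub_add_cancel]

/-- If `p ≤ q`, a set contributes at most the `1/q`-th power of its measure. -/
theorem rpow_mul_rpow_le {p q : ℝ} (hp : 0 < p) (hpq : p ≤ q) {b m v : ℝ≥0∞}
    (hb0 : b ≠ 0) (hb : b ≠ ∞) (hv0 : v ≠ 0) (hv : v ≠ ∞) (hmb : m ≤ b) (hmv : m ≤ v) :
    b ^ ((1:ℝ)/q - 1/p) * m ^ ((1:ℝ)/p) ≤ v ^ ((1:ℝ)/q) := by
  have hq : 0 < q := hp.trans_le hpq
  have hle : (1:ℝ)/q ≤ 1/p := one_div_le_one_div_of_le hp hpq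
  rcases le_total b v with hbv | hvb
  · calc b ^ ((1:ℝ)/q - 1/p) * m ^ ((1:ℝ)/p)
        ≤ b ^ ((1:ℝ)/q - 1/p) * b ^ ((1:ℝ)/p) := by gcongr
      _ = b ^ ((1:ℝ)/q) := by rw [← ENNReal.rpow_add _ _ hb0 hb, sub_add_cancel]
      _ ≤ v ^ ((1:ℝ)/q) := by gcongr
  · calc b ^ ((1:ℝ)/q - 1/p) * m ^ ((1:ℝ)/p)
        ≤ v ^ ((1:ℝ)/q - 1/p) * v ^ ((1:ℝ)/p) := by
          gcongr ?_ * ?_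
          · exact ENNReal.rpow_le_rpow_of_nonpos hvb (by linarith)
          · gcongr
      _ = v ^ ((1:ℝ)/q) := by rw [← ENNReal.rpow_add _ _ hv0 hv, sub_add_cancel]

/-- If `b` is much larger than `v`, then a subset of measure `2 * v` contributes at most
`v ^ (1 / q)`. -/
theorem rpow_mul_two_mul_rpow_le {p q : ℝ} (hp : 0 < p) (hpq : p < q) {b v : ℝ≥0∞}
    (hv0 : v ≠ 0) (hv : v ≠ ∞) (hb : 2 ^ (q / (q - p)) * v ≤ b) :
    b ^ ((1:ℝ)/q - 1/p) * (2 * v) ^ ((1:ℝ)/p) ≤ v ^ ((1:ℝ)/q) := by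
  have hq : 0 < q := hp.trans hpq
  have hlt : (1:ℝ)/q < 1/p := one_div_lt_one_div_of_lt hp hpq
  have hqp : q - p ≠ 0 := by linarith
  calc b ^ ((1:ℝ)/q - 1/p) * (2 * v) ^ ((1:ℝ)/p)
      ≤ (2 ^ (q / (q - p)) * v) ^ ((1:ℝ)/q - 1/p) * (2 * v) ^ ((1:ℝ)/p) := by
        gcongr ?_ * _
        exact ENNReal.rpow_le_rpow_of_nonpos hb (by linarith)
    _ = v ^ ((1:ℝ)/q) := by
        rw [ENNReal.mul_rpow_of_ne_top (by finiteness) hv,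
          ENNReal.mul_rpow_of_nonneg _ _ (by positivity), mul_mul_mul_comm, ← ENNReal.rpow_mul,
          ← ENNReal.rpow_add _ _ two_ne_zero ENNReal.ofNat_ne_top,
          ← ENNReal.rpow_add _ _ hv0 hv, sub_add_cancel]
        have : q / (q - p) * (1 / q - 1 / p) + 1 / p = 0 := by field_simp; ring
        rw [this, ENNReal.rpow_zero, one_mul]

/-- A function whose modulus is the indicator of two unit balls that are far apart has
Morrey norm at most that of the indicator of a single one. -/
theorem morreyNorm_le_of_abs_eq_indicator_union {p q : ℝ} {d : ℕ} (hp : 0 < p) (hpq : p < q)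
    (hd : 1 ≤ d) {K : ℝ} (hK1 : 1 ≤ K) (hK : 2 ^ (q / (q - p)) ≤ K)
    {x : EuclideanSpace ℝ (Fin d)} (hx : 2 * K + 2 ≤ ‖x‖) {f : EuclideanSpace ℝ (Fin d) → ℝ}
    (hf : ∀ y, |f y| = (Metric.ball 0 1 ∪ Metric.ball x 1).indicator (fun _ => 1) y) :
    morreyNorm p q d f ≤
      volume (Metric.ball (0 : EuclideanSpace ℝ (Fin d)) 1) ^ ((1:ℝ)/q) := by
  have hE : MeasurableSet (Metric.ball (0 : EuclideanSpace ℝ (Fin d)) 1 ∪ Metric.ball x 1) :=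
    Metric.isOpen_ball.measurableSet.union Metric.isOpen_ball.measurableSet
  have hxv : volume (Metric.ball x 1) =
      volume (Metric.ball (0 : EuclideanSpace ℝ (Fin d)) 1) := Measure.addHaar_ball_center _ _ _
  set v := volume (Metric.ball (0 : EuclideanSpace ℝ (Fin d)) 1)
  have hv0 : v ≠ 0 := (Metric.measure_ball_pos volume _ one_pos).ne'
  have hv : v ≠ ∞ := measure_ball_lt_top.ne
  refine iSup_le fun a => iSup_le fun r => iSup_le fun hr => ?_
  have hb0 := (Metric.measure_ball_pos volume a hr).ne'
  have hb : volume (Metric.ball a r) ≠ ∞ := measure_ball_lt_top.ne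
  rw [rpow_lintegral_of_abs_eq_indicator _ hp zero_le_one hE hf, ENNReal.ofReal_one, one_mul,
    Measure.restrict_apply hE]
  rcases le_or_gt K r with hKr | hrK
  · refine le_trans ?_ (rpow_mul_two_mul_rpow_le hp hpq (b := volume (Metric.ball a r)) hv0 hv ?_)
    · gcongr
      calc _ ≤ volume (Metric.ball (0 : EuclideanSpace ℝ (Fin d)) 1 ∪ Metric.ball x 1) :=
            measure_mono Set.inter_subset_left
        _ ≤ v + volume (Metric.ball x 1) := measure_union_le _ _
        _ = 2 * v := by rw [hxv, two_mul]
    · rw [Measure.addHaar_ball_of_pos _ _ hr, finrank_euclideanSpace_fin]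
      gcongr
      calc (2 : ℝ≥0∞) ^ (q / (q - p)) = ENNReal.ofReal (2 ^ (q / (q - p))) := by
            rw [← ENNReal.ofReal_rpow_of_pos two_pos, ENNReal.ofReal_ofNat]
        _ ≤ ENNReal.ofReal (r ^ d) := ENNReal.ofReal_le_ofReal <|
            hK.trans <| hKr.trans <| le_self_pow₀ (hK1.trans hKr) (by omega)
  · refine rpow_mul_rpow_le hp hpq.le hb0 hb hv0 hv (measure_mono Set.inter_subset_right) ?_
    have hmeet : (Metric.ball (0 : EuclideanSpace ℝ (Fin d)) 1 ∪ Metric.ball x 1) ∩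
        Metric.ball a r ⊆ Metric.ball 0 1 ∨
        (Metric.ball (0 : EuclideanSpace ℝ (Fin d)) 1 ∪ Metric.ball x 1) ∩
        Metric.ball a r ⊆ Metric.ball x 1 := by
      by_contra! h
      obtain ⟨h0, h1⟩ := h
      obtain ⟨y, ⟨hy, hya⟩, hy0⟩ := Set.not_subset.1 h0
      obtain ⟨z, ⟨hz, hza⟩, hzx⟩ := Set.not_subset.1 h1
      have hy := hy.resolve_left hy0
      have hz := hz.resolve_right hzx
      rw [Metric.mem_ball] at hya hza hy hz
      have h2 : dist x 0 ≤ dist x y + dist y a + dist a z + dist z 0 := by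
        linarith [dist_triangle x y 0, dist_triangle y a 0, dist_triangle a z 0]
      rw [dist_zero_right, dist_comm x y, dist_comm a z] at h2
      linarith
    rcases hmeet with h | h
    · exact measure_mono h
    · exact (measure_mono h).trans_eq hxv

/-- The von Neumann–Jordan constant of the Morrey space `M^p_q(ℝ^d)` equals `2`
when `1 ≤ p < q < ∞` and `d ≥ 1`. -/
theorem vonNeumannJordan_morrey (p q : ℝ) (d : ℕ) (hp : 1 ≤ p) (hpq : p < q) (hd : 1 ≤ d) :
    (⨆ (f : EuclideanSpace ℝ (Fin d) → ℝ) (g : EuclideanSpace ℝ (Fin d) → ℝ)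
      (_ : Measurable f) (_ : Measurable g)
      (_ : morreyNorm p q d f ≠ ∞) (_ : morreyNorm p q d g ≠ ∞)
      (_ : morreyNorm p q d f ≠ 0) (_ : morreyNorm p q d g ≠ 0),
      ((morreyNorm p q d (f + g)) ^ 2 + (morreyNorm p q d (f - g)) ^ 2) /
        (2 * ((morreyNorm p q d f) ^ 2 + (morreyNorm p q d g) ^ 2))) = 2 := by
  have hp0 : 0 < p := by linarith
  apply le_antisymm
  · refine iSup_le fun f => iSup_le fun g => iSup_le fun hf => iSup_le fun hg => iSup_le fun _ =>
      iSup_le fun _ => iSup_le fun _ => iSup_le fun _ => ENNReal.div_le_of_le_mul ?_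
    calc (morreyNorm p q d (f + g)) ^ 2 + (morreyNorm p q d (f - g)) ^ 2
        ≤ (morreyNorm p q d f + morreyNorm p q d g) ^ 2 +
          (morreyNorm p q d f + morreyNorm p q d g) ^ 2 := by
          gcongr
          · exact morreyNorm_add_le q hp hf hg
          · exact morreyNorm_sub_le q hp hf hg
      _ ≤ 2 * (2 * ((morreyNorm p q d f) ^ 2 + (morreyNorm p q d g) ^ 2)) := by
          rw [← two_mul]
          gcongr
          exact ENNReal.add_sq_le_two_mul _ _
  · have : NeZero d := ⟨by omega⟩
    obtain ⟨K, hK1, hK⟩ : ∃ K : ℝ, 1 ≤ K ∧ 2 ^ (q / (q - p)) ≤ K :=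
      ⟨max 1 (2 ^ (q / (q - p))), le_max_left _ _, le_max_right _ _⟩
    obtain ⟨x, hx⟩ : ∃ x : EuclideanSpace ℝ (Fin d), ‖x‖ = 2 * K + 2 :=
      ⟨EuclideanSpace.single 0 (2 * K + 2), by
        rw [PiLp.norm_single, Real.norm_of_nonneg (by linarith)]⟩
    set A := Metric.ball (0 : EuclideanSpace ℝ (Fin d)) 1
    set B := Metric.ball x 1 with hB_def
    have hA : MeasurableSet A := Metric.isOpen_ball.measurableSet
    have hB : MeasurableSet B := Metric.isOpen_ball.measurableSet
    have hAB : Disjoint A B := Metric.ball_disjoint_ball (by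
      rw [dist_zero_left, hx]; linarith)
    have hBv : volume B = volume A := Measure.addHaar_ball_center _ _ _
    have hv0 : volume A ≠ 0 := (Metric.measure_ball_pos volume _ one_pos).ne'
    have hv : volume A ≠ ∞ := measure_ball_lt_top.ne
    set N := volume A ^ ((1:ℝ)/q) with hN_def
    have hN0 : N ≠ 0 := by simp [hN_def, hv0, hv]
    have hN : N ≠ ∞ := ENNReal.rpow_ne_top_of_nonneg (by simp; linarith) hv
    set f : EuclideanSpace ℝ (Fin d) → ℝ := A.indicator 1 + B.indicator 1
    set g : EuclideanSpace ℝ (Fin d) → ℝ := A.indicator 1 - B.indicator 1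
    have hABy : ∀ y, y ∈ A → y ∉ B := fun y h h' => Set.disjoint_left.1 hAB h h'
    have hf : ∀ y, |f y| = (A ∪ B).indicator (fun _ => 1) y := fun y => by
      by_cases h1 : y ∈ A
      · have h2 := hABy y h1
        simp [f, h1, h2]
      · by_cases h2 : y ∈ B <;> simp [f, h1, h2]
    have hg : ∀ y, |g y| = (A ∪ B).indicator (fun _ => 1) y := fun y => by
      by_cases h1 : y ∈ A
      · have h2 := hABy y h1
        simp [g, h1, h2]
      · by_cases h2 : y ∈ B <;> simp [g, h1, h2]
    have hadd : ∀ y, |(f + g) y| = A.indicator (fun _ => 2) y := fun y => by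
      by_cases h1 : y ∈ A
      · have h2 := hABy y h1
        simp [f, g, h1, h2, one_add_one_eq_two]
      · by_cases h2 : y ∈ B <;> simp [f, g, h1, h2]
    have hsub : ∀ y, |(f - g) y| = B.indicator (fun _ => 2) y := fun y => by
      by_cases h1 : y ∈ A
      · have h2 := hABy y h1
        simp [f, g, h1, h2]
      · by_cases h2 : y ∈ B <;> simp [f, g, h1, h2, one_add_one_eq_two]
    have hfm : Measurable f := (measurable_one.indicator hA).add (measurable_one.indicator hB)
    have hgm : Measurable g := (measurable_one.indicator hA).sub (measurable_one.indicator hB)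
    have hnorm : ∀ h : EuclideanSpace ℝ (Fin d) → ℝ,
        (∀ y, |h y| = (A ∪ B).indicator (fun _ => 1) y) → morreyNorm p q d h = N := fun h hh => by
      refine le_antisymm
        (morreyNorm_le_of_abs_eq_indicator_union hp0 hpq hd hK1 hK hx.ge hh) ?_
      simpa [N, A] using le_morreyNorm_of_abs_eq_indicator q hp0 zero_le_one (hA.union hB) hh
        one_pos Set.subset_union_left
    have h1 : 2 * N ≤ morreyNorm p q d (f + g) := by
      simpa [N, A] using le_morreyNorm_of_abs_eq_indicator q hp0 zero_le_two hA hadd one_pos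
        subset_rfl
    have h2 : 2 * N ≤ morreyNorm p q d (f - g) := by
      have := le_morreyNorm_of_abs_eq_indicator q hp0 zero_le_two hB hsub one_pos subset_rfl
      rwa [← hB_def, hBv, ENNReal.ofReal_ofNat] at this
    have hfN := hnorm f hf
    have hgN := hnorm g hg
    refine le_iSup_of_le f <| le_iSup_of_le g <| le_iSup_of_le hfm <| le_iSup_of_le hgm <|
      le_iSup_of_le (hfN ▸ hN) <| le_iSup_of_le (hgN ▸ hN) <| le_iSup_of_le (hfN ▸ hN0) <|
      le_iSup_of_le (hgN ▸ hN0) ?_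
    rw [hfN, hgN, ENNReal.le_div_iff_mul_le (by simp [hN0]) (by simp [hN, ENNReal.mul_eq_top])]
    calc 2 * (2 * (N ^ 2 + N ^ 2)) = (2 * N) ^ 2 + (2 * N) ^ 2 := by ring
      _ ≤ _ := by gcongr
end

section
/- Let 1 ≤ p < q < ∞ and d ≥ 1. Then the von Neumann–Jordan constant of the discrete Morrey space ℓ^p_q(ℤ^d) equals 2; that is, sup{ (‖x+y‖²_{ℓ^p_q} + ‖x−y‖²_{ℓ^p_q}) / (2(‖x‖²_{ℓ^p_q} + ‖y‖²_{ℓ^p_q})) : x, y ∈ ℓ^p_q(ℤ^d), x ≠ 0, y ≠ 0 } = 2. -/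
open MeasureTheory
open scoped ENNReal

/-- The discrete Morrey norm `‖x‖_{ℓ^p_q}` of `x : ℤ^d → ℝ`:
the supremum over `m ∈ ℤ^d` and `N ∈ ℕ` of
`|S_{m,N}|^(1/q - 1/p) (∑_{k ∈ S_{m,N}} |x k|^p)^(1/p)`, where
`S_{m,N} = {k : ‖k - m‖_∞ ≤ N}` has cardinality `(2N+1)^d`. -/
noncomputable def discreteMorreyNorm (p q : ℝ) (d : ℕ) (x : (Fin d → ℤ) → ℝ) : ℝ≥0∞ :=
  ⨆ (m : Fin d → ℤ) (N : ℕ),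
    (((2 * N + 1) ^ d : ℕ) : ℝ≥0∞) ^ ((1:ℝ)/q - 1/p) *
      (∑ k ∈ Fintype.piFinset (fun i => Finset.Icc (m i - (N:ℤ)) (m i + (N:ℤ))),
        ENNReal.ofReal (|x k| ^ p)) ^ ((1:ℝ)/p)

theorem discreteMorreyNorm_neg (p q : ℝ) (d : ℕ) (x : (Fin d → ℤ) → ℝ) :
    discreteMorreyNorm p q d (-x) = discreteMorreyNorm p q d x := by
  simp [discreteMorreyNorm]

theorem discreteMorreyNorm_add_le {p : ℝ} (q : ℝ) (d : ℕ) (hp : 1 ≤ p)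
    (x y : (Fin d → ℤ) → ℝ) :
    discreteMorreyNorm p q d (x + y) ≤ discreteMorreyNorm p q d x + discreteMorreyNorm p q d y := by
  have hp0 : 0 ≤ p := by linarith
  refine iSup₂_le fun m N => ?_
  refine le_trans ?_ (add_le_add (le_iSup₂ m N) (le_iSup₂ m N))
  rw [← mul_add]
  gcongr
  simp only [← ENNReal.ofReal_rpow_of_nonneg (abs_nonneg _) hp0]
  refine le_trans ?_ (ENNReal.Lp_add_le _ _ _ hp)
  gcongr with k
  rw [← ENNReal.ofReal_add (abs_nonneg _) (abs_nonneg _)]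
  exact ENNReal.ofReal_le_ofReal (abs_add_le _ _)

theorem discreteMorreyNorm_sub_le {p : ℝ} (q : ℝ) (d : ℕ) (hp : 1 ≤ p)
    (x y : (Fin d → ℤ) → ℝ) :
    discreteMorreyNorm p q d (x - y) ≤ discreteMorreyNorm p q d x + discreteMorreyNorm p q d y := by
  rw [sub_eq_add_neg, ← discreteMorreyNorm_neg p q d y]
  exact discreteMorreyNorm_add_le q d hp x (-y)

theorem ofReal_abs_le_discreteMorreyNorm {p : ℝ} (q : ℝ) (d : ℕ) (hp : 1 ≤ p)
    (x : (Fin d → ℤ) → ℝ) (k : Fin d → ℤ) :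
    ENNReal.ofReal |x k| ≤ discreteMorreyNorm p q d x := by
  have hp0 : 0 < p := by linarith
  refine le_trans (le_of_eq ?_) (le_iSup₂ k 0)
  simp [← ENNReal.ofReal_rpow_of_nonneg (abs_nonneg _) hp0.le, Fintype.piFinset_singleton,
    ENNReal.rpow_rpow_inv hp0.ne']

/-- Two unit masses placed far enough apart on the diagonal have discrete Morrey norm at most `1`. -/
theorem exists_discreteMorreyNorm_le_one {p q : ℝ} {d : ℕ} (hp : 1 ≤ p) (hpq : p < q)
    (hd : 1 ≤ d) :
    ∃ K : Fin d → ℤ, K ≠ 0 ∧ ∀ f : (Fin d → ℤ) → ℝ, (∀ k, |f k| ≤ 1) →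
      (∀ k, k ≠ 0 → k ≠ K → f k = 0) → discreteMorreyNorm p q d f ≤ 1 := by
  have hp0 : 0 < p := by linarith
  have hs : 0 < 1 / p - 1 / q := sub_pos.2 (one_div_lt_one_div_of_lt hp0 hpq)
  obtain ⟨n, hn⟩ := ENNReal.exists_nat_gt
    (ENNReal.rpow_ne_top_of_nonneg (inv_nonneg.2 hs.le) (ENNReal.ofNat_ne_top (n := 2)))
  have hn2 : (2 : ℝ≥0∞) ≤ (n : ℝ≥0∞) ^ (1 / p - 1 / q) := by
    have := ENNReal.rpow_le_rpow hn.le hs.le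
    rwa [ENNReal.rpow_inv_rpow hs.ne'] at this
  have hn0 : n ≠ 0 := by
    rintro rfl
    simp at hn
  let i₀ : Fin d := ⟨0, hd⟩
  refine ⟨fun _ => (n : ℤ), fun h => hn0 (by simpa using congrFun h i₀), fun f hf hf0 => ?_⟩
  refine iSup₂_le fun m N => ?_
  set S := Fintype.piFinset (fun i => Finset.Icc (m i - (N : ℤ)) (m i + (N : ℤ)))
  set K : Fin d → ℤ := fun _ => (n : ℤ) with hK
  have hsum : ∑ k ∈ S, ENNReal.ofReal (|f k| ^ p) ≤
      (if (0 : Fin d → ℤ) ∈ S then 1 else 0) + (if K ∈ S then 1 else 0) := by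
    calc ∑ k ∈ S, ENNReal.ofReal (|f k| ^ p)
        ≤ ∑ k ∈ S, ((if (0 : Fin d → ℤ) = k then 1 else 0) + (if K = k then 1 else 0)) := by
          refine Finset.sum_le_sum fun k _ => ?_
          have h1 : ENNReal.ofReal (|f k| ^ p) ≤ 1 :=
            ENNReal.ofReal_le_one.2 (Real.rpow_le_one (abs_nonneg _) (hf k) hp0.le)
          by_cases h0 : (0 : Fin d → ℤ) = k
          · rw [if_pos h0]
            exact h1.trans le_self_add
          by_cases hk : K = k
          · rw [if_pos hk]
            exact h1.trans le_add_self
          simp [hf0 k (Ne.symm h0) (Ne.symm hk), Real.zero_rpow hp0.ne']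
      _ = _ := by
          rw [Finset.sum_add_distrib, Finset.sum_ite_eq, Finset.sum_ite_eq]
  have hcard : ((1 : ℕ) : ℝ≥0∞) ≤ (((2 * N + 1) ^ d : ℕ) : ℝ≥0∞) :=
    Nat.cast_le.2 (Nat.one_le_pow _ _ (by lia))
  rw [← neg_sub, ENNReal.rpow_neg, mul_comm, ← div_eq_mul_inv]
  refine ENNReal.div_le_of_le_mul ?_
  rw [one_mul]
  by_cases hmem : (0 : Fin d → ℤ) ∈ S ∧ K ∈ S
  · have hN : n ≤ (2 * N + 1) ^ d := by
      have h0 := Finset.mem_Icc.1 (Fintype.mem_piFinset.1 hmem.1 i₀)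
      have h1 := Finset.mem_Icc.1 (Fintype.mem_piFinset.1 hmem.2 i₀)
      simp only [Pi.zero_apply, hK] at h0 h1
      exact le_trans (by lia) (Nat.le_self_pow (by lia) (2 * N + 1))
    rw [if_pos hmem.1, if_pos hmem.2, one_add_one_eq_two] at hsum
    calc (∑ k ∈ S, ENNReal.ofReal (|f k| ^ p)) ^ (1 / p)
        ≤ 2 ^ (1 / p) := by gcongr
      _ ≤ 2 ^ (1 : ℝ) := ENNReal.rpow_le_rpow_of_exponent_le (by norm_num)
          ((div_le_one hp0).2 hp)
      _ = 2 := ENNReal.rpow_one _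
      _ ≤ (n : ℝ≥0∞) ^ (1 / p - 1 / q) := hn2
      _ ≤ _ := by gcongr
  · have hle : ∑ k ∈ S, ENNReal.ofReal (|f k| ^ p) ≤ 1 := by
      refine hsum.trans ?_
      split_ifs with h0 h1 <;> simp_all
    calc (∑ k ∈ S, ENNReal.ofReal (|f k| ^ p)) ^ (1 / p)
        ≤ 1 := ENNReal.rpow_le_one hle (by positivity)
      _ ≤ _ := ENNReal.one_le_rpow (by simpa using hcard) hs

/-- The von Neumann–Jordan constant of the discrete Morrey space `ℓ^p_q(ℤ^d)` equals `2`
when `1 ≤ p < q < ∞` and `d ≥ 1`. -/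
theorem vonNeumannJordan_discreteMorrey (p q : ℝ) (d : ℕ)
    (hp : 1 ≤ p) (hpq : p < q) (hd : 1 ≤ d) :
    (⨆ (x : (Fin d → ℤ) → ℝ) (y : (Fin d → ℤ) → ℝ)
      (_ : discreteMorreyNorm p q d x ≠ ∞) (_ : discreteMorreyNorm p q d y ≠ ∞)
      (_ : x ≠ 0) (_ : y ≠ 0),
      ((discreteMorreyNorm p q d (x + y)) ^ 2 + (discreteMorreyNorm p q d (x - y)) ^ 2) /
        (2 * ((discreteMorreyNorm p q d x) ^ 2 + (discreteMorreyNorm p q d y) ^ 2))) = 2 := by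
  apply le_antisymm
  · refine iSup₂_le fun x y => iSup₂_le fun _ _ => iSup₂_le fun _ _ => ?_
    refine ENNReal.div_le_of_le_mul ?_
    set a := discreteMorreyNorm p q d x
    set b := discreteMorreyNorm p q d y
    calc discreteMorreyNorm p q d (x + y) ^ 2 + discreteMorreyNorm p q d (x - y) ^ 2
        ≤ (a + b) ^ 2 + (a + b) ^ 2 := by
          gcongr
          · exact discreteMorreyNorm_add_le q d hp x y
          · exact discreteMorreyNorm_sub_le q d hp x y
      _ = 2 * (a + b) ^ 2 := (two_mul _).symm
      _ ≤ 2 * (2 * (a ^ 2 + b ^ 2)) := by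
          gcongr
          exact ENNReal.add_sq_le_two_mul a b
  · obtain ⟨K, hK, hle⟩ := exists_discreteMorreyNorm_le_one hp hpq hd
    let x : (Fin d → ℤ) → ℝ := Pi.single 0 1 + Pi.single K 1
    let y : (Fin d → ℤ) → ℝ := Pi.single 0 1 - Pi.single K 1
    have hx : discreteMorreyNorm p q d x ≤ 1 := by
      refine hle x (fun k => ?_) (fun k h0 h1 => by simp [x, h0, h1])
      by_cases h0 : k = 0
      · simp [x, h0, hK.symm]
      · by_cases h1 : k = K <;> simp [x, h0, h1, hK]
    have hy : discreteMorreyNorm p q d y ≤ 1 := by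
      refine hle y (fun k => ?_) (fun k h0 h1 => by simp [y, h0, h1])
      by_cases h0 : k = 0
      · simp [y, h0, hK.symm]
      · by_cases h1 : k = K <;> simp [y, h0, h1, hK]
    have hadd : 2 ≤ discreteMorreyNorm p q d (x + y) := by
      refine le_trans ?_ (ofReal_abs_le_discreteMorreyNorm q d hp _ 0)
      simp [x, y, hK.symm, one_add_one_eq_two]
    have hsub : 2 ≤ discreteMorreyNorm p q d (x - y) := by
      refine le_trans ?_ (ofReal_abs_le_discreteMorreyNorm q d hp _ K)
      simp [x, y, hK, one_add_one_eq_two]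
    have hx0 : x ≠ 0 := fun h => by simpa [x, hK.symm] using congrFun h 0
    have hy0 : y ≠ 0 := fun h => by simpa [y, hK.symm] using congrFun h 0
    have hden : 2 * (discreteMorreyNorm p q d x ^ 2 + discreteMorreyNorm p q d y ^ 2) ≤ 4 :=
      calc _ ≤ 2 * ((1 : ℝ≥0∞) ^ 2 + 1 ^ 2) := by gcongr
        _ = 4 := by norm_num
    have hnum : 8 ≤ discreteMorreyNorm p q d (x + y) ^ 2 + discreteMorreyNorm p q d (x - y) ^ 2 :=
      calc (8 : ℝ≥0∞) = 2 ^ 2 + 2 ^ 2 := by norm_num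
        _ ≤ _ := by gcongr
    refine le_trans ?_ (le_iSup₂_of_le x y <|
      le_iSup₂_of_le (ne_top_of_le_ne_top ENNReal.one_ne_top hx)
        (ne_top_of_le_ne_top ENNReal.one_ne_top hy) <|
      le_iSup₂_of_le hx0 hy0 le_rfl)
    calc (2 : ℝ≥0∞) = 8 / 4 := by
          rw [ENNReal.eq_div_iff (by norm_num) (by norm_num)]
          norm_num
      _ ≤ _ := ENNReal.div_le_div hnum hden
end

section
/- Let 1 ≤ p < q < ∞ and d ≥ 1. Then the Dunkl–Williams constant of the discrete Morrey space ℓ^p_q(ℤ^d) equals 4; that is, sup{ ((‖x‖_{ℓ^p_q} + ‖y‖_{ℓ^p_q}) / ‖x−y‖_{ℓ^p_q}) · ‖ x/‖x‖_{ℓ^p_q} − y/‖y‖_{ℓ^p_q} ‖_{ℓ^p_q} : x, y ∈ ℓ^p_q(ℤ^d), x ≠ 0, y ≠ 0, x ≠ y } = 4. -/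
open MeasureTheory
open scoped ENNReal

namespace DiscreteMorrey

variable {p q : ℝ} {d : ℕ}

/-- The cube of centre `m` and radius `N` for the sup norm. -/
noncomputable def cube (m : Fin d → ℤ) (N : ℕ) : Finset (Fin d → ℤ) :=
  Fintype.piFinset fun i => Finset.Icc (m i - (N : ℤ)) (m i + (N : ℤ))

lemma norm_eq_iSup_enorm (hp : 0 ≤ p) (x : (Fin d → ℤ) → ℝ) :
    discreteMorreyNorm p q d x = ⨆ (m : Fin d → ℤ) (N : ℕ),
      (((2 * N + 1) ^ d : ℕ) : ℝ≥0∞) ^ ((1:ℝ)/q - 1/p) *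
        (∑ k ∈ cube m N, ‖x k‖ₑ ^ p) ^ ((1:ℝ)/p) := by
  simp only [discreteMorreyNorm, cube, Real.enorm_eq_ofReal_abs,
    ENNReal.ofReal_rpow_of_nonneg (abs_nonneg _) hp]

lemma norm_add_le (hp : 1 ≤ p) (x y : (Fin d → ℤ) → ℝ) :
    discreteMorreyNorm p q d (x + y) ≤
      discreteMorreyNorm p q d x + discreteMorreyNorm p q d y := by
  have hp0 : 0 ≤ p := by linarith
  simp only [norm_eq_iSup_enorm hp0]
  refine iSup₂_le fun m N => ?_
  calc _ ≤ (((2 * N + 1) ^ d : ℕ) : ℝ≥0∞) ^ ((1:ℝ)/q - 1/p) *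
        ((∑ k ∈ cube m N, ‖x k‖ₑ ^ p) ^ ((1:ℝ)/p) +
          (∑ k ∈ cube m N, ‖y k‖ₑ ^ p) ^ ((1:ℝ)/p)) := by
        gcongr
        refine le_trans ?_ (ENNReal.Lp_add_le _ _ _ hp)
        gcongr
        exact enorm_add_le _ _
    _ ≤ _ := by
        rw [mul_add]
        exact add_le_add (le_iSup₂_of_le m N le_rfl) (le_iSup₂_of_le m N le_rfl)

lemma norm_smul (hp : 1 ≤ p) (c : ℝ) (x : (Fin d → ℤ) → ℝ) :
    discreteMorreyNorm p q d (c • x) = ‖c‖ₑ * discreteMorreyNorm p q d x := by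
  have hp0 : 0 < p := by linarith
  simp only [norm_eq_iSup_enorm hp0.le, ENNReal.mul_iSup]
  congr! 4 with m N
  simp only [Pi.smul_apply, smul_eq_mul, enorm_mul, ENNReal.mul_rpow_of_nonneg _ _ hp0.le,
    ← Finset.mul_sum]
  rw [ENNReal.mul_rpow_of_nonneg _ _ (by positivity), ← ENNReal.rpow_mul,
    mul_one_div_cancel hp0.ne', ENNReal.rpow_one]
  ring

lemma enorm_apply_le_norm (hp : 1 ≤ p) (x : (Fin d → ℤ) → ℝ) (k : Fin d → ℤ) :
    ‖x k‖ₑ ≤ discreteMorreyNorm p q d x := by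
  have hp0 : 0 < p := by linarith
  rw [norm_eq_iSup_enorm hp0.le]
  refine le_iSup₂_of_le k 0 ?_
  have hc : cube k 0 = {k} := by
    ext j
    simp [cube, funext_iff]
  rw [hc, Finset.sum_singleton, ← ENNReal.rpow_mul, mul_one_div_cancel hp0.ne']
  simp

lemma norm_ne_zero (hp : 1 ≤ p) {x : (Fin d → ℤ) → ℝ} (hx : x ≠ 0) :
    discreteMorreyNorm p q d x ≠ 0 := by
  obtain ⟨k, hk⟩ := Function.ne_iff.1 hx
  have h := enorm_apply_le_norm (q := q) hp x k
  intro h0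
  rw [h0] at h
  exact hk (by simpa using h)

lemma norm_sub_comm (hp : 1 ≤ p) (x y : (Fin d → ℤ) → ℝ) :
    discreteMorreyNorm p q d (x - y) = discreteMorreyNorm p q d (y - x) := by
  rw [← neg_sub, ← neg_one_smul ℝ, norm_smul hp]
  simp

lemma norm_sub_le (hp : 1 ≤ p) (x y : (Fin d → ℤ) → ℝ) :
    discreteMorreyNorm p q d (x - y) ≤
      discreteMorreyNorm p q d x + discreteMorreyNorm p q d y := by
  rw [sub_eq_add_neg]
  refine (norm_add_le hp x (-y)).trans_eq ?_
  rw [← neg_one_smul ℝ y, norm_smul hp]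
  simp

/-- Bound for the distance of two normalized vectors, weighted by the norm of the first one. -/
lemma norm_mul_norm_normalize_sub_le (hp : 1 ≤ p) {x y : (Fin d → ℤ) → ℝ}
    (hx : discreteMorreyNorm p q d x ≠ ∞) (hy : discreteMorreyNorm p q d y ≠ ∞)
    (hx0 : x ≠ 0) (hy0 : y ≠ 0) :
    discreteMorreyNorm p q d x * discreteMorreyNorm p q d
        ((discreteMorreyNorm p q d x).toReal⁻¹ • x - (discreteMorreyNorm p q d y).toReal⁻¹ • y) ≤
      2 * discreteMorreyNorm p q d (x - y) := by
  have hc : discreteMorreyNorm p q d (x - y) ≠ ∞ :=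
    ne_top_of_le_ne_top (ENNReal.add_ne_top.2 ⟨hx, hy⟩) (norm_sub_le hp x y)
  have hyx : discreteMorreyNorm p q d y ≤
      discreteMorreyNorm p q d x + discreteMorreyNorm p q d (x - y) := by
    simpa using norm_sub_le (q := q) hp x (x - y)
  have hxy : discreteMorreyNorm p q d x ≤
      discreteMorreyNorm p q d (x - y) + discreteMorreyNorm p q d y := by
    simpa using norm_add_le (q := q) hp (x - y) y
  have ha : 0 < (discreteMorreyNorm p q d x).toReal :=
    ENNReal.toReal_pos (norm_ne_zero hp hx0) hx
  have hb : 0 < (discreteMorreyNorm p q d y).toReal :=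
    ENNReal.toReal_pos (norm_ne_zero hp hy0) hy
  have hsplit (a b : ℝ) : a⁻¹ • x - b⁻¹ • y = a⁻¹ • (x - y) + (a⁻¹ - b⁻¹) • y := by module
  rw [hsplit]
  refine (mul_le_mul_right (norm_add_le hp _ _) _).trans ?_
  rw [norm_smul hp, norm_smul hp]
  generalize discreteMorreyNorm p q d x = X at *
  generalize discreteMorreyNorm p q d y = Y at *
  generalize discreteMorreyNorm p q d (x - y) = Z at *
  lift X to NNReal using hx
  lift Y to NNReal using hy
  lift Z to NNReal using hc
  rw [← ENNReal.toReal_le_toReal (by finiteness) (by finiteness)]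
  simp only [ENNReal.coe_toReal] at *
  norm_cast at hxy hyx
  rw [← NNReal.coe_le_coe] at hxy hyx
  push_cast at hxy hyx
  rw [ENNReal.toReal_mul, ENNReal.toReal_add (by finiteness) (by finiteness)]
  simp only [ENNReal.coe_toReal, ENNReal.toReal_mul, toReal_enorm, Real.norm_eq_abs,
    ENNReal.toReal_ofNat]
  have h1 : (X : ℝ)⁻¹ - (Y : ℝ)⁻¹ = (Y - X) / (X * Y) := by field_simp
  rw [h1, abs_div, abs_of_pos (mul_pos ha hb), abs_of_pos (inv_pos.2 ha)]
  have h2 : (X : ℝ) * ((X : ℝ)⁻¹ * Z + |(Y : ℝ) - X| / (X * Y) * Y) = Z + |(Y : ℝ) - X| := by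
    field_simp
  rw [h2]
  have : |(Y : ℝ) - X| ≤ Z := abs_le.2 ⟨by linarith, by linarith⟩
  linarith

lemma dunklWilliams_le (hp : 1 ≤ p) {x y : (Fin d → ℤ) → ℝ}
    (hx : discreteMorreyNorm p q d x ≠ ∞) (hy : discreteMorreyNorm p q d y ≠ ∞)
    (hx0 : x ≠ 0) (hy0 : y ≠ 0) (hxy : x ≠ y) :
    (discreteMorreyNorm p q d x + discreteMorreyNorm p q d y) / discreteMorreyNorm p q d (x - y) *
      discreteMorreyNorm p q d ((discreteMorreyNorm p q d x).toReal⁻¹ • x -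
        (discreteMorreyNorm p q d y).toReal⁻¹ • y) ≤ 4 := by
  have hc : discreteMorreyNorm p q d (x - y) ≠ ∞ :=
    ne_top_of_le_ne_top (ENNReal.add_ne_top.2 ⟨hx, hy⟩) (norm_sub_le hp x y)
  have hc0 : discreteMorreyNorm p q d (x - y) ≠ 0 := norm_ne_zero hp (sub_ne_zero.2 hxy)
  have h1 := norm_mul_norm_normalize_sub_le hp hx hy hx0 hy0
  have h2 := norm_mul_norm_normalize_sub_le hp hy hx hy0 hx0
  rw [norm_sub_comm hp y x, norm_sub_comm hp (_ • y)] at h2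
  rw [div_eq_mul_inv, mul_right_comm, ← div_eq_mul_inv,
    ENNReal.div_le_iff hc0 hc, add_mul]
  refine (add_le_add h1 h2).trans_eq ?_
  ring

/-- The function with value `a` at `0`, value `b` at `(K, …, K)` and value `0` elsewhere. -/
def twoPoint (d K : ℕ) (a b : ℝ) : (Fin d → ℤ) → ℝ :=
  fun k => if k = 0 then a else if k = (fun _ => (K : ℤ)) then b else 0

lemma twoPoint_zero (K : ℕ) (a b : ℝ) : twoPoint d K a b 0 = a := by
  simp [twoPoint]

lemma const_ne_zero (hd : 1 ≤ d) {K : ℕ} (hK : 1 ≤ K) :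
    (fun _ : Fin d => (K : ℤ)) ≠ 0 := fun h => by
  have := congrFun h ⟨0, hd⟩
  simp at this
  omega

lemma twoPoint_const (hd : 1 ≤ d) {K : ℕ} (hK : 1 ≤ K) (a b : ℝ) :
    twoPoint d K a b (fun _ => (K : ℤ)) = b := by
  simp [twoPoint, const_ne_zero hd hK]

lemma smul_twoPoint (K : ℕ) (c a b : ℝ) :
    c • twoPoint d K a b = twoPoint d K (c * a) (c * b) := by
  ext k
  simp only [twoPoint, Pi.smul_apply, smul_eq_mul]
  split_ifs <;> simp

lemma twoPoint_sub (K : ℕ) (a b a' b' : ℝ) :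
    twoPoint d K a b - twoPoint d K a' b' = twoPoint d K (a - a') (b - b') := by
  ext k
  simp only [twoPoint, Pi.sub_apply]
  split_ifs <;> simp

lemma le_two_mul_of_mem_cube (hd : 1 ≤ d) {K N : ℕ} {m : Fin d → ℤ} (h0 : 0 ∈ cube m N)
    (h1 : (fun _ => (K : ℤ)) ∈ cube m N) : K ≤ 2 * N := by
  simp only [cube, Fintype.mem_piFinset, Finset.mem_Icc, Pi.zero_apply] at h0 h1
  have := h0 ⟨0, hd⟩
  have := h1 ⟨0, hd⟩
  omega

lemma sum_twoPoint_le (hp : 1 ≤ p) (K : ℕ) (a b : ℝ) (s : Finset (Fin d → ℤ)) :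
    ∑ k ∈ s, ‖twoPoint d K a b k‖ₑ ^ p ≤
      (if 0 ∈ s then max ‖a‖ₑ ‖b‖ₑ ^ p else 0) +
        (if (fun _ => (K : ℤ)) ∈ s then max ‖a‖ₑ ‖b‖ₑ ^ p else 0) := by
  have hp0 : 0 < p := by linarith
  rw [← Finset.sum_ite_eq' s 0 (fun _ => max ‖a‖ₑ ‖b‖ₑ ^ p),
    ← Finset.sum_ite_eq' s (fun _ => (K : ℤ)) (fun _ => max ‖a‖ₑ ‖b‖ₑ ^ p),
    ← Finset.sum_add_distrib]
  refine Finset.sum_le_sum fun k _ => ?_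
  unfold twoPoint
  split_ifs
  · exact le_add_right (by gcongr; exact le_max_left _ _)
  · exact le_add_right (by gcongr; exact le_max_left _ _)
  · exact le_add_left (by gcongr; exact le_max_right _ _)
  · simp [hp0]

/-- Two sufficiently distant points span an isometric copy of the plane with the sup norm. -/
lemma exists_norm_twoPoint (hp : 1 ≤ p) (hpq : p < q) (hd : 1 ≤ d) :
    ∃ K : ℕ, ∀ a b : ℝ,
      discreteMorreyNorm p q d (twoPoint d K a b) = ENNReal.ofReal (max |a| |b|) := by
  have hp0 : 0 < p := by linarith
  have he : (1:ℝ)/q - 1/p < 0 := sub_neg.2 (one_div_lt_one_div_of_lt hp0 hpq)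
  obtain ⟨K, hK⟩ := ENNReal.exists_nat_gt
    (show (2 : ℝ≥0∞) ^ (-(1/p) / ((1:ℝ)/q - 1/p)) ≠ ∞ by finiteness)
  have hcard {n : ℕ} (hn : K ≤ n) : (n : ℝ≥0∞) ^ ((1:ℝ)/q - 1/p) * 2 ^ (1/p) ≤ 1 := by
    calc (n : ℝ≥0∞) ^ ((1:ℝ)/q - 1/p) * 2 ^ (1/p)
        ≤ ((2 : ℝ≥0∞) ^ (-(1/p) / ((1:ℝ)/q - 1/p))) ^ ((1:ℝ)/q - 1/p) * 2 ^ (1/p) := by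
          gcongr ?_ * _
          rw [← neg_neg ((1:ℝ)/q - 1/p), ENNReal.rpow_neg _ (-_), ENNReal.rpow_neg _ (-_), neg_neg]
          refine ENNReal.inv_le_inv.2
            (ENNReal.rpow_le_rpow (hK.le.trans ?_) (neg_nonneg.2 he.le))
          exact_mod_cast hn
      _ = 1 := by
          rw [← ENNReal.rpow_mul, div_mul_cancel₀ _ he.ne,
            ← ENNReal.rpow_add _ _ (by simp) (by simp)]
          simp
  have hone {n : ℕ} (hn : 1 ≤ n) : (n : ℝ≥0∞) ^ ((1:ℝ)/q - 1/p) ≤ 1 :=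
    ENNReal.rpow_le_one_of_one_le_of_neg (by exact_mod_cast hn) he
  refine ⟨K + 1, fun a b => ?_⟩
  have hmax : ENNReal.ofReal (max |a| |b|) = max ‖a‖ₑ ‖b‖ₑ := by
    rw [ENNReal.ofReal_max, Real.enorm_eq_ofReal_abs, Real.enorm_eq_ofReal_abs]
  have hroot : (max ‖a‖ₑ ‖b‖ₑ ^ p) ^ (1/p) = max ‖a‖ₑ ‖b‖ₑ := by
    rw [← ENNReal.rpow_mul, mul_one_div_cancel hp0.ne', ENNReal.rpow_one]
  rw [hmax]
  refine le_antisymm ?_ (max_le ?_ ?_)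
  · rw [norm_eq_iSup_enorm hp0.le]
    refine iSup₂_le fun m N => ?_
    refine (mul_le_mul_right (ENNReal.rpow_le_rpow (sum_twoPoint_le hp _ a b _)
      (by positivity : 0 ≤ 1/p)) _).trans ?_
    by_cases h : 0 ∈ cube m N ∧ (fun _ => ((K + 1 : ℕ) : ℤ)) ∈ cube m N
    · have hN := le_two_mul_of_mem_cube hd h.1 h.2
      have hK' : K ≤ (2 * N + 1) ^ d := by
        have := Nat.le_self_pow (n := d) (by omega) (2 * N + 1)
        omega
      rw [if_pos h.1, if_pos h.2, ← two_mul, ENNReal.mul_rpow_of_nonneg _ _ (by positivity),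
        hroot, ← mul_assoc]
      exact mul_le_of_le_one_left' (hcard hK')
    · refine (mul_le_mul' (hone (Nat.one_le_pow _ _ (by omega))) (ENNReal.rpow_le_rpow
        (z := 1/p) (y := max ‖a‖ₑ ‖b‖ₑ ^ p) ?_ (by positivity))).trans_eq (by rw [hroot, one_mul])
      split_ifs <;> simp_all
  · simpa only [twoPoint_zero] using
      enorm_apply_le_norm (q := q) hp (twoPoint d (K + 1) a b) 0
  · simpa only [twoPoint_const hd (Nat.le_add_left 1 K)] using
      enorm_apply_le_norm (q := q) hp (twoPoint d (K + 1) a b) (fun _ => ((K + 1 : ℕ) : ℤ))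

end DiscreteMorrey

/-- The Dunkl–Williams constant of the discrete Morrey space `ℓ^p_q(ℤ^d)` equals `4`
when `1 ≤ p < q < ∞` and `d ≥ 1`. -/
theorem dunklWilliams_discreteMorrey (p q : ℝ) (d : ℕ)
    (hp : 1 ≤ p) (hpq : p < q) (hd : 1 ≤ d) :
    (⨆ (x : (Fin d → ℤ) → ℝ) (y : (Fin d → ℤ) → ℝ)
      (_ : discreteMorreyNorm p q d x ≠ ∞) (_ : discreteMorreyNorm p q d y ≠ ∞)
      (_ : x ≠ 0) (_ : y ≠ 0) (_ : x ≠ y),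
      ((discreteMorreyNorm p q d x + discreteMorreyNorm p q d y) /
          discreteMorreyNorm p q d (x - y)) *
        discreteMorreyNorm p q d
          ((discreteMorreyNorm p q d x).toReal⁻¹ • x -
            (discreteMorreyNorm p q d y).toReal⁻¹ • y)) = 4 := by
  refine le_antisymm (iSup₂_le fun x y => iSup₂_le fun hx hy => iSup₂_le fun hx0 hy0 =>
    iSup_le fun hxy => DiscreteMorrey.dunklWilliams_le hp hx hy hx0 hy0 hxy) ?_
  obtain ⟨K, hnorm⟩ := DiscreteMorrey.exists_norm_twoPoint hp hpq hd
  have hlim : Filter.Tendsto (fun t : ℝ => ENNReal.ofReal (2 * (2 + t) / (1 + t)))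
      (nhdsWithin 0 (Set.Ioi 0)) (nhds 4) := by
    have hcont : ContinuousAt (fun t : ℝ => 2 * (2 + t) / (1 + t)) 0 := by
      fun_prop (disch := norm_num)
    have h := ENNReal.tendsto_ofReal (hcont.tendsto.mono_left
      (nhdsWithin_le_nhds (s := Set.Ioi 0)))
    norm_num at h
    exact h
  refine le_of_tendsto hlim ?_
  filter_upwards [Ioo_mem_nhdsGT one_pos] with t ⟨ht0, ht1⟩
  have hx : discreteMorreyNorm p q d (DiscreteMorrey.twoPoint d K 1 1) = ENNReal.ofReal 1 := by
    simp [hnorm]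
  have hy : discreteMorreyNorm p q d (DiscreteMorrey.twoPoint d K (1 + t) (1 - t)) =
      ENNReal.ofReal (1 + t) := by
    rw [hnorm, abs_of_pos (by linarith), abs_of_pos (by linarith), max_eq_left (by linarith)]
  have hxy : discreteMorreyNorm p q d (DiscreteMorrey.twoPoint d K 1 1 -
      DiscreteMorrey.twoPoint d K (1 + t) (1 - t)) = ENNReal.ofReal t := by
    rw [DiscreteMorrey.twoPoint_sub, hnorm]
    simp [abs_of_pos ht0]
  have hne {x : (Fin d → ℤ) → ℝ} {r : ℝ} (hr : 0 < r)
      (h : discreteMorreyNorm p q d x = ENNReal.ofReal r) : x ≠ 0 := by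
    rintro rfl
    have h0 := DiscreteMorrey.norm_smul (q := q) (d := d) hp 0 0
    rw [zero_smul, h] at h0
    simp at h0
    linarith
  refine le_iSup₂_of_le (DiscreteMorrey.twoPoint d K 1 1)
    (DiscreteMorrey.twoPoint d K (1 + t) (1 - t)) ?_
  refine le_iSup₂_of_le (by simp [hx]) (by simp [hy]) ?_
  refine le_iSup₂_of_le (hne one_pos hx) (hne (by linarith) hy) ?_
  refine le_iSup_of_le (sub_ne_zero.1 (hne ht0 hxy)) (le_of_eq ?_)
  rw [hx, hy, hxy, ENNReal.toReal_ofReal zero_le_one, ENNReal.toReal_ofReal (by linarith),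
    DiscreteMorrey.smul_twoPoint, DiscreteMorrey.smul_twoPoint, DiscreteMorrey.twoPoint_sub, hnorm,
    ← ENNReal.ofReal_add (by linarith) (by linarith), ← ENNReal.ofReal_div_of_pos ht0,
    ← ENNReal.ofReal_mul (by positivity)]
  have h1 : (1:ℝ)⁻¹ * 1 - (1 + t)⁻¹ * (1 + t) = 0 := by field_simp; ring
  have h2 : (1:ℝ)⁻¹ * 1 - (1 + t)⁻¹ * (1 - t) = 2 * t / (1 + t) := by field_simp; ring
  rw [h1, h2, abs_zero, abs_of_pos (by positivity), max_eq_right (by positivity)]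
  congr 1
  field_simp
  ring
end

section
/- Let 1 ≤ p < q < ∞ and d ≥ 1. Then the von Neumann–Jordan constant of the local Morrey space LM^p_q(ℝ^d) equals 2; that is, sup{ (‖f+g‖²_{LM^p_q} + ‖f−g‖²_{LM^p_q}) / (2(‖f‖²_{LM^p_q} + ‖g‖²_{LM^p_q})) : f, g ∈ LM^p_q(ℝ^d), f ≠ 0, g ≠ 0 } = 2. -/
open MeasureTheory
open scoped ENNReal

/-- The local Morrey norm `‖f‖_{LM^p_q}` of a (measurable) function on `ℝ^d`:
the supremum over all balls `B = B(0,r)` centered at the origin of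
`|B|^(1/q - 1/p) (∫_B |f|^p)^(1/p)`. -/
noncomputable def localMorreyNorm (p q : ℝ) (d : ℕ) (f : EuclideanSpace ℝ (Fin d) → ℝ) : ℝ≥0∞ :=
  ⨆ (r : ℝ) (_ : 0 < r),
    volume (Metric.ball (0 : EuclideanSpace ℝ (Fin d)) r) ^ ((1:ℝ)/q - 1/p) *
      (∫⁻ y in Metric.ball (0 : EuclideanSpace ℝ (Fin d)) r, ENNReal.ofReal (|f y| ^ p)) ^ ((1:ℝ)/p)

open Metric Filter Topology

section RadialPowers

variable {d : ℕ}

lemma integrableOn_ball_norm_rpow (hd : 1 ≤ d) {a : ℝ} (ha : a < d) (r : ℝ) :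
    IntegrableOn (fun x : EuclideanSpace ℝ (Fin d) => ‖x‖ ^ (-a)) (ball 0 r) := by
  refine integrableOn_ball_of_norm_le_rpow (C := 1) (α := a) (by simpa using hd) (by simpa using ha)
    (Eventually.of_forall fun x => ?_) (Measurable.aestronglyMeasurable (by fun_prop))
  rw [one_mul, Real.norm_of_nonneg (by positivity)]

lemma integral_ball_norm_rpow (a : ℝ) {r : ℝ} (hr : 0 < r) :
    ∫ x in ball (0 : EuclideanSpace ℝ (Fin d)) r, ‖x‖ ^ (-a) =
      (∫ x in ball (0 : EuclideanSpace ℝ (Fin d)) 1, ‖x‖ ^ (-a)) * r ^ (d - a) := by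
  have h := Measure.setIntegral_comp_smul_of_pos volume
    (fun x : EuclideanSpace ℝ (Fin d) => ‖x‖ ^ (-a)) (ball 0 1) hr
  rw [smul_unitBall_of_pos hr, finrank_euclideanSpace_fin, smul_eq_mul,
    eq_inv_mul_iff_mul_eq₀ (by positivity)] at h
  rw [← h]
  simp_rw [norm_smul, Real.norm_of_nonneg hr.le, Real.mul_rpow hr.le (norm_nonneg _)]
  rw [integral_const_mul, sub_eq_add_neg, Real.rpow_add hr, Real.rpow_natCast]
  ring

lemma integral_unitBall_norm_rpow_pos (hd : 1 ≤ d) {a : ℝ} (ha : a < d) :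
    0 < ∫ x in ball (0 : EuclideanSpace ℝ (Fin d)) 1, ‖x‖ ^ (-a) := by
  have : Nonempty (Fin d) := ⟨⟨0, hd⟩⟩
  rw [setIntegral_pos_iff_support_of_nonneg_ae
    (Eventually.of_forall fun x => by simp only [Pi.zero_apply]; positivity)
    (integrableOn_ball_norm_rpow hd ha 1)]
  have hsub : ball (0 : EuclideanSpace ℝ (Fin d)) 1 \ {0} ⊆
      Function.support (fun x : EuclideanSpace ℝ (Fin d) => ‖x‖ ^ (-a)) ∩ ball 0 1 := by
    rintro x ⟨hx, hx0⟩
    exact ⟨(Real.rpow_pos_of_pos (norm_pos_iff.2 hx0) _).ne', hx⟩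
  refine lt_of_lt_of_le ?_ (measure_mono hsub)
  rw [measure_sdiff_null (measure_singleton _)]
  exact measure_ball_pos _ _ one_pos

/-- Integrals of radial powers `|x|^(-a)` with `a < d` over centred balls. -/
lemma exists_lintegral_ball_norm_rpow (hd : 1 ≤ d) {a : ℝ} (ha : a < d) :
    ∃ K : ℝ, 0 < K ∧ ∀ r : ℝ, 0 < r →
      ∫⁻ x in ball (0 : EuclideanSpace ℝ (Fin d)) r, ENNReal.ofReal (‖x‖ ^ (-a)) =
        ENNReal.ofReal (K * r ^ (d - a)) := by
  refine ⟨_, integral_unitBall_norm_rpow_pos hd ha, fun r hr => ?_⟩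
  rw [← integral_ball_norm_rpow a hr, ofReal_integral_eq_lintegral_ofReal
    (integrableOn_ball_norm_rpow hd ha r) (Eventually.of_forall fun x => by
      simp only [Pi.zero_apply]; positivity)]

end RadialPowers

section LocalMorrey

variable {p q : ℝ} {d : ℕ}

/-- The scaling behind local Morrey norms: if `∫_{B_r} |f|^p` is `L r^(d - dp/q)`, the quantity
inside the supremum does not involve `r`. -/
lemma volume_ball_rpow_mul (hp : 0 < p) {L r : ℝ} (hL : 0 ≤ L)
    (hr : 0 < r) :
    volume (ball (0 : EuclideanSpace ℝ (Fin d)) r) ^ ((1:ℝ)/q - 1/p) *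
      ENNReal.ofReal (L * r ^ (d - d * p / q)) ^ ((1:ℝ)/p) =
    ENNReal.ofReal ((volume.real (ball (0 : EuclideanSpace ℝ (Fin d)) 1)) ^ ((1:ℝ)/q - 1/p) *
      L ^ ((1:ℝ)/p)) := by
  have hV : 0 < volume.real (ball (0 : EuclideanSpace ℝ (Fin d)) 1) :=
    ENNReal.toReal_pos (measure_ball_pos _ _ one_pos).ne' measure_ball_lt_top.ne
  have hvol : volume (ball (0 : EuclideanSpace ℝ (Fin d)) r) =
      ENNReal.ofReal (r ^ d * volume.real (ball (0 : EuclideanSpace ℝ (Fin d)) 1)) := by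
    rw [Measure.addHaar_ball_of_pos _ _ hr, finrank_euclideanSpace_fin,
      ENNReal.ofReal_mul (by positivity), ofReal_measureReal measure_ball_lt_top.ne]
  rw [hvol, ENNReal.ofReal_rpow_of_pos (by positivity),
    ENNReal.ofReal_rpow_of_nonneg (by positivity) (by positivity),
    ← ENNReal.ofReal_mul (by positivity), Real.mul_rpow (by positivity) hV.le,
    Real.mul_rpow hL (by positivity), ← Real.rpow_natCast, ← Real.rpow_mul hr.le,
    ← Real.rpow_mul hr.le]
  have hexp : (d : ℝ) * (1/q - 1/p) + (d - d * p / q) * (1/p) = 0 := by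
    field_simp
    ring
  congr 1
  calc _ = (volume.real (ball (0 : EuclideanSpace ℝ (Fin d)) 1)) ^ ((1:ℝ)/q - 1/p) *
      L ^ ((1:ℝ)/p) * (r ^ ((d : ℝ) * (1/q - 1/p)) * r ^ ((d - d * p / q) * (1/p))) := by ring
    _ = _ := by rw [← Real.rpow_add hr, hexp, Real.rpow_zero, mul_one]

lemma le_localMorreyNorm (f : EuclideanSpace ℝ (Fin d) → ℝ) {r : ℝ} (hr : 0 < r) :
    volume (ball (0 : EuclideanSpace ℝ (Fin d)) r) ^ ((1:ℝ)/q - 1/p) *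
      (∫⁻ y in ball (0 : EuclideanSpace ℝ (Fin d)) r, ENNReal.ofReal (|f y| ^ p)) ^ ((1:ℝ)/p)
      ≤ localMorreyNorm p q d f :=
  le_iSup₂_of_le r hr le_rfl

lemma localMorreyNorm_neg (f : EuclideanSpace ℝ (Fin d) → ℝ) :
    localMorreyNorm p q d (-f) = localMorreyNorm p q d f := by
  simp [localMorreyNorm]

lemma localMorreyNorm_add_le (hp : 1 ≤ p) {f g : EuclideanSpace ℝ (Fin d) → ℝ}
    (hf : Measurable f) (hg : Measurable g) :
    localMorreyNorm p q d (f + g) ≤ localMorreyNorm p q d f + localMorreyNorm p q d g := by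
  have hp0 : 0 < p := by linarith
  refine iSup₂_le fun r hr => ?_
  refine le_trans ?_ (add_le_add (le_localMorreyNorm f hr) (le_localMorreyNorm g hr))
  rw [← mul_add]
  gcongr
  have hpow : ∀ u : ℝ, ENNReal.ofReal (|u| ^ p) = ENNReal.ofReal |u| ^ p := fun u =>
    (ENNReal.ofReal_rpow_of_nonneg (abs_nonneg u) hp0.le).symm
  simp_rw [hpow]
  refine le_trans ?_ (ENNReal.lintegral_Lp_add_le (by fun_prop) (by fun_prop) hp)
  gcongr with y
  simp only [Pi.add_apply]
  rw [← ENNReal.ofReal_add (abs_nonneg _) (abs_nonneg _)]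
  exact ENNReal.ofReal_le_ofReal (abs_add_le _ _)

lemma localMorreyNorm_sub_le (hp : 1 ≤ p) {f g : EuclideanSpace ℝ (Fin d) → ℝ}
    (hf : Measurable f) (hg : Measurable g) :
    localMorreyNorm p q d (f - g) ≤ localMorreyNorm p q d f + localMorreyNorm p q d g := by
  rw [sub_eq_add_neg, ← localMorreyNorm_neg g]
  exact localMorreyNorm_add_le hp hf hg.neg

end LocalMorrey

lemma ENNReal.sq_add_sq_div_le_two {a b s t : ℝ≥0∞} (ha : a ≠ ∞) (hb : b ≠ ∞)
    (hs : s ≤ a + b) (ht : t ≤ a + b) : (s ^ 2 + t ^ 2) / (2 * (a ^ 2 + b ^ 2)) ≤ 2 := by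
  refine ENNReal.div_le_of_le_mul ?_
  calc s ^ 2 + t ^ 2 ≤ (a + b) ^ 2 + (a + b) ^ 2 := by gcongr
    _ ≤ 2 * (2 * (a ^ 2 + b ^ 2)) := by
      lift a to NNReal using ha
      lift b to NNReal using hb
      norm_cast
      rw [← NNReal.coe_le_coe]
      push_cast
      nlinarith [sq_nonneg ((a : ℝ) - b)]

/-- Two functions of equal local Morrey norm whose sum and difference both have at least twice
that norm: `|x|^(-d/q)`, and the same function with its sign changed outside the unit ball. -/
lemma exists_localMorreyNorm_add_sub (p q : ℝ) (d : ℕ) (hp : 1 ≤ p) (hpq : p < q)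
    (hd : 1 ≤ d) :
    ∃ (f g : EuclideanSpace ℝ (Fin d) → ℝ) (c : ℝ), Measurable f ∧ Measurable g ∧ 0 < c ∧
      localMorreyNorm p q d f = ENNReal.ofReal c ∧ localMorreyNorm p q d g = ENNReal.ofReal c ∧
      ENNReal.ofReal (2 * c) ≤ localMorreyNorm p q d (f + g) ∧
      ENNReal.ofReal (2 * c) ≤ localMorreyNorm p q d (f - g) := by
  classical
  have hp0 : 0 < p := by linarith
  have hq0 : 0 < q := by linarith
  have hd0 : (0 : ℝ) < d := by exact_mod_cast hd
  have ha : d * p / q < d := by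
    rw [div_lt_iff₀ hq0]
    gcongr
  obtain ⟨K, hK, hball⟩ := exists_lintegral_ball_norm_rpow hd ha
  set V := volume.real (ball (0 : EuclideanSpace ℝ (Fin d)) 1)
  have hV : 0 < V :=
    ENNReal.toReal_pos (measure_ball_pos _ _ one_pos).ne' measure_ball_lt_top.ne
  set f : EuclideanSpace ℝ (Fin d) → ℝ := fun x => ‖x‖ ^ (-(d / q)) with hf
  set g : EuclideanSpace ℝ (Fin d) → ℝ := (ball 0 1).piecewise f (-f) with hg
  have hfm : Measurable f := by fun_prop
  have hfp : ∀ x, |f x| ^ p = ‖x‖ ^ (-(d * p / q)) := fun x => by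
    rw [abs_of_nonneg (by positivity), ← Real.rpow_mul (norm_nonneg _)]
    congr 1
    ring
  have hgp : ∀ x, |g x| = |f x| := fun x => by
    by_cases hx : x ∈ ball (0 : EuclideanSpace ℝ (Fin d)) 1
    · rw [hg, Set.piecewise_eq_of_mem _ _ _ hx]
    · rw [hg, Set.piecewise_eq_of_notMem _ _ _ hx, Pi.neg_apply, abs_neg]
  have htwo : V ^ ((1:ℝ)/q - 1/p) * (2 ^ p * K) ^ ((1:ℝ)/p) =
      2 * (V ^ ((1:ℝ)/q - 1/p) * K ^ ((1:ℝ)/p)) := by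
    rw [Real.mul_rpow (by positivity) hK.le, ← Real.rpow_mul (by norm_num),
      mul_one_div_cancel hp0.ne', Real.rpow_one]
    ring
  have hfp2 : ∀ x, ENNReal.ofReal (|2 * f x| ^ p) =
      ENNReal.ofReal (2 ^ p) * ENNReal.ofReal (‖x‖ ^ (-(d * p / q))) := fun x => by
    rw [abs_mul, Real.mul_rpow (abs_nonneg _) (abs_nonneg _), hfp, abs_two,
      ENNReal.ofReal_mul (by positivity)]
  have hfn : localMorreyNorm p q d f = ENNReal.ofReal (V ^ ((1:ℝ)/q - 1/p) * K ^ ((1:ℝ)/p)) := by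
    have hterm : ∀ r : ℝ, 0 < r → volume (ball (0 : EuclideanSpace ℝ (Fin d)) r) ^
        ((1:ℝ)/q - 1/p) * (∫⁻ y in ball (0 : EuclideanSpace ℝ (Fin d)) r,
          ENNReal.ofReal (|f y| ^ p)) ^ ((1:ℝ)/p) =
        ENNReal.ofReal (V ^ ((1:ℝ)/q - 1/p) * K ^ ((1:ℝ)/p)) := fun r hr => by
      simp_rw [hfp]
      rw [hball r hr, volume_ball_rpow_mul hp0 hK.le hr]
    exact le_antisymm (iSup₂_le fun r hr => (hterm r hr).le)
      ((hterm 1 one_pos).ge.trans (le_localMorreyNorm f one_pos))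
  refine ⟨f, g, V ^ ((1:ℝ)/q - 1/p) * K ^ ((1:ℝ)/p), hfm,
    hfm.piecewise measurableSet_ball hfm.neg, by positivity, hfn, ?_, ?_, ?_⟩
  · rw [← hfn]
    simp only [localMorreyNorm, hgp]
  · refine le_trans (le_of_eq ?_) (le_localMorreyNorm (f + g) one_pos)
    have hadd : ∫⁻ y in ball (0 : EuclideanSpace ℝ (Fin d)) 1, ENNReal.ofReal (|(f + g) y| ^ p) =
        ENNReal.ofReal (2 ^ p * K * 1 ^ (d - d * p / q)) := by
      rw [mul_assoc, ENNReal.ofReal_mul (by positivity), ← hball 1 one_pos,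
        ← lintegral_const_mul _ (by fun_prop)]
      refine setLIntegral_congr_fun measurableSet_ball fun x hx => ?_
      rw [← hfp2, Pi.add_apply, hg, Set.piecewise_eq_of_mem _ _ _ hx, two_mul]
    rw [hadd, volume_ball_rpow_mul hp0 (by positivity) one_pos, htwo]
  · have hs : 0 < d - d * p / q := by linarith
    have hlow : ∀ r : ℝ, 1 ≤ r → ENNReal.ofReal (V ^ ((1:ℝ)/q - 1/p) *
        (2 ^ p * K * (1 - r ^ (-(d - d * p / q)))) ^ ((1:ℝ)/p)) ≤
          localMorreyNorm p q d (f - g) := by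
      intro r hr
      have hr0 : 0 < r := by linarith
      have hpos : 0 ≤ 1 - r ^ (-(d - d * p / q)) :=
        sub_nonneg.2 (Real.rpow_le_one_of_one_le_of_nonpos hr (by linarith))
      refine le_trans ?_ (le_localMorreyNorm (f - g) hr0)
      rw [← volume_ball_rpow_mul hp0 (by positivity) hr0]
      gcongr
      have hdiff : ∫⁻ x in ball (0 : EuclideanSpace ℝ (Fin d)) r \ ball 0 1,
          ENNReal.ofReal (‖x‖ ^ (-(d * p / q))) =
            ENNReal.ofReal (K * (1 - r ^ (-(d - d * p / q))) * r ^ (d - d * p / q)) := by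
        have h := lintegral_inter_add_sdiff (μ := volume)
          (fun x : EuclideanSpace ℝ (Fin d) => ENNReal.ofReal (‖x‖ ^ (-(d * p / q))))
          (ball 0 r) (measurableSet_ball (x := 0) (ε := 1))
        rw [Set.inter_eq_right.2 (ball_subset_ball hr), hball 1 one_pos, hball r hr0,
          Real.one_rpow, mul_one, add_comm] at h
        rw [ENNReal.eq_sub_of_add_eq ENNReal.ofReal_ne_top h, ← ENNReal.ofReal_sub _ hK.le,
          mul_assoc, sub_mul, ← Real.rpow_add hr0, neg_add_cancel, Real.rpow_zero]
        ring_nf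
      rw [mul_assoc, mul_assoc, ENNReal.ofReal_mul (by positivity), ← mul_assoc, ← hdiff,
        ← lintegral_const_mul _ (by fun_prop)]
      refine le_trans (le_of_eq ?_) (lintegral_mono_set (Set.sdiff_subset (t := ball 0 1)))
      refine setLIntegral_congr_fun (measurableSet_ball.diff measurableSet_ball) fun x hx => ?_
      rw [← hfp2, Pi.sub_apply, hg, Set.piecewise_eq_of_notMem _ _ _ hx.2, Pi.neg_apply,
        sub_neg_eq_add, two_mul]
    refine le_of_tendsto ?_ ((eventually_ge_atTop 1).mono hlow)
    refine ENNReal.tendsto_ofReal ?_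
    rw [← htwo]
    refine Tendsto.const_mul _ (Tendsto.rpow_const ?_ (Or.inr (by positivity)))
    simpa using ((tendsto_rpow_neg_atTop hs).const_sub 1).const_mul (2 ^ p * K)

/-- The von Neumann–Jordan constant of the local Morrey space `LM^p_q(ℝ^d)` equals `2`
when `1 ≤ p < q < ∞` and `d ≥ 1`. -/
theorem vonNeumannJordan_localMorrey (p q : ℝ) (d : ℕ) (hp : 1 ≤ p) (hpq : p < q) (hd : 1 ≤ d) :
    (⨆ (f : EuclideanSpace ℝ (Fin d) → ℝ) (g : EuclideanSpace ℝ (Fin d) → ℝ)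
      (_ : Measurable f) (_ : Measurable g)
      (_ : localMorreyNorm p q d f ≠ ∞) (_ : localMorreyNorm p q d g ≠ ∞)
      (_ : localMorreyNorm p q d f ≠ 0) (_ : localMorreyNorm p q d g ≠ 0),
      ((localMorreyNorm p q d (f + g)) ^ 2 + (localMorreyNorm p q d (f - g)) ^ 2) /
        (2 * ((localMorreyNorm p q d f) ^ 2 + (localMorreyNorm p q d g) ^ 2))) = 2 := by
  refine le_antisymm ?_ ?_
  · refine iSup_le fun f => iSup_le fun g => iSup_le fun hf => iSup_le fun hg =>
      iSup_le fun hf' => iSup_le fun hg' => iSup_le fun _ => iSup_le fun _ => ?_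
    exact ENNReal.sq_add_sq_div_le_two hf' hg' (localMorreyNorm_add_le hp hf hg)
      (localMorreyNorm_sub_le hp hf hg)
  · obtain ⟨f, g, c, hf, hg, hc, hfn, hgn, hadd, hsub⟩ :=
      exists_localMorreyNorm_add_sub p q d hp hpq hd
    refine le_iSup_of_le f <| le_iSup_of_le g <| le_iSup_of_le hf <| le_iSup_of_le hg <|
      le_iSup_of_le (by simp [hfn]) <| le_iSup_of_le (by simp [hgn]) <|
      le_iSup_of_le (by simp [hfn, hc]) <| le_iSup_of_le (by simp [hgn, hc]) ?_
    rw [hfn, hgn, ENNReal.le_div_iff_mul_le (by simp [hc]) (Or.inl (by finiteness))]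
    calc 2 * (2 * (ENNReal.ofReal c ^ 2 + ENNReal.ofReal c ^ 2))
        = ENNReal.ofReal (2 * c) ^ 2 + ENNReal.ofReal (2 * c) ^ 2 := by
          rw [ENNReal.ofReal_mul (by norm_num), ENNReal.ofReal_ofNat]
          ring
      _ ≤ _ := by gcongr
end

section
/- Let 1 ≤ p < q < ∞ and d ≥ 1, and let f(x) := |x|^{−d/q} for x ∈ ℝ^d (where |x| is the Euclidean norm). Then f belongs to the Morrey space M^p_q(ℝ^d), i.e., ‖f‖_{M^p_q} < ∞; moreover ‖f‖_{M^p_q} > 0. -/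
open MeasureTheory
open scoped ENNReal

section Helpers

open Metric Module

variable {E : Type*} [NormedAddCommGroup E] [NormedSpace ℝ E] [FiniteDimensional ℝ E]
  [MeasurableSpace E] [BorelSpace E] (μ : Measure E) [μ.IsAddHaarMeasure]

theorem setLIntegral_ball_zero_norm_rpow (s : ℝ) {r : ℝ} (hr : 0 < r) :
    ∫⁻ y in ball (0 : E) r, ENNReal.ofReal (‖y‖ ^ (-s)) ∂μ =
      ENNReal.ofReal (r ^ ((finrank ℝ E : ℝ) - s)) *
        ∫⁻ y in ball (0 : E) 1, ENNReal.ofReal (‖y‖ ^ (-s)) ∂μ := by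
  have hpre : (fun y : E => r • y) ⁻¹' ball 0 r = ball 0 1 := by
    ext y
    simp [norm_smul, abs_of_pos hr, hr]
  have h := setLIntegral_map (μ := μ) (g := fun y : E => r • y) (measurableSet_ball (x := 0) (ε := r))
    (f := fun y => ENNReal.ofReal (‖y‖ ^ (-s))) (by fun_prop) (measurable_const_smul r)
  have hmul : ∀ y : E, ENNReal.ofReal (‖r • y‖ ^ (-s)) =
      ENNReal.ofReal (r ^ (-s)) * ENNReal.ofReal (‖y‖ ^ (-s)) := fun y => by
    rw [norm_smul, Real.norm_of_nonneg hr.le, Real.mul_rpow hr.le (norm_nonneg y),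
      ENNReal.ofReal_mul (by positivity)]
  simp_rw [hpre, hmul] at h
  rw [lintegral_const_mul _ (by fun_prop), Measure.map_addHaar_smul μ hr.ne',
    Measure.restrict_smul, lintegral_smul_measure, smul_eq_mul, abs_of_pos (by positivity)] at h
  have hrd : 0 < r ^ finrank ℝ E := by positivity
  rw [sub_eq_add_neg, Real.rpow_add hr, Real.rpow_natCast, ENNReal.ofReal_mul hrd.le, mul_assoc,
    ← h, ← mul_assoc, ← ENNReal.ofReal_mul hrd.le, mul_inv_cancel₀ hrd.ne', ENNReal.ofReal_one,
    one_mul]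

theorem setLIntegral_ball_norm_rpow_le {s : ℝ} (hs : 0 ≤ s) (a : E) {r : ℝ} (hr : 0 < r) :
    ∫⁻ y in ball a r, ENNReal.ofReal (‖y‖ ^ (-s)) ∂μ ≤
      ENNReal.ofReal (r ^ ((finrank ℝ E : ℝ) - s)) *
        (∫⁻ y in ball (0 : E) 1, ENNReal.ofReal (‖y‖ ^ (-s)) ∂μ + μ (ball 0 1)) := by
  rw [← lintegral_inter_add_sdiff _ (ball a r) (measurableSet_ball (x := (0 : E)) (ε := r)), mul_add,
    ← setLIntegral_ball_zero_norm_rpow μ s hr]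
  gcongr
  · exact Set.inter_subset_right
  calc ∫⁻ y in ball a r \ ball 0 r, ENNReal.ofReal (‖y‖ ^ (-s)) ∂μ
      ≤ ∫⁻ _ in ball a r \ ball 0 r, ENNReal.ofReal (r ^ (-s)) ∂μ := by
        refine setLIntegral_mono measurable_const fun y hy => ENNReal.ofReal_le_ofReal ?_
        exact Real.rpow_le_rpow_of_nonpos hr (by simpa using hy.2) (by linarith)
    _ = ENNReal.ofReal (r ^ (-s)) * μ (ball a r \ ball 0 r) := setLIntegral_const _ _
    _ ≤ ENNReal.ofReal (r ^ (-s)) * μ (ball a r) := by gcongr; exact Set.sdiff_subset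
    _ = ENNReal.ofReal (r ^ ((finrank ℝ E : ℝ) - s)) * μ (ball 0 1) := by
        rw [Measure.addHaar_ball_of_pos μ a hr, ← mul_assoc, ← ENNReal.ofReal_mul (by positivity),
          ← Real.rpow_natCast, ← Real.rpow_add hr, neg_add_eq_sub]

theorem setLIntegral_unitBall_norm_rpow_ne_top (hd : 1 ≤ finrank ℝ E) {s : ℝ}
    (hs : s < finrank ℝ E) :
    ∫⁻ y in ball (0 : E) 1, ENNReal.ofReal (‖y‖ ^ (-s)) ∂μ ≠ ∞ := by
  have h : IntegrableOn (fun y : E => ‖y‖ ^ (-s)) (ball 0 1) μ := by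
    refine integrableOn_ball_of_norm_le_rpow hd (C := 1) hs (Filter.Eventually.of_forall fun y => ?_)
      (Measurable.aestronglyMeasurable (by fun_prop))
    rw [one_mul, Real.norm_of_nonneg (by positivity)]
  exact h.lintegral_lt_top.ne

end Helpers

/-- For `1 ≤ p < q < ∞` and `d ≥ 1`, the function `f(x) = |x|^(-d/q)` belongs to the
Morrey space `M^p_q(ℝ^d)`, i.e. its Morrey norm is finite; moreover its norm is positive. -/
theorem rpow_mem_morrey (p q : ℝ) (d : ℕ) (hp : 1 ≤ p) (hpq : p < q) (hd : 1 ≤ d)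
    (f : EuclideanSpace ℝ (Fin d) → ℝ) (hf : f = fun x => ‖x‖ ^ (-(d : ℝ) / q)) :
    morreyNorm p q d f ≠ ∞ ∧ morreyNorm p q d f ≠ 0 := by
  have hp0 : 0 < p := by linarith
  have hq0 : 0 < q := by linarith
  have hd0 : (0 : ℝ) < d := by exact_mod_cast hd
  have hdim : Module.finrank ℝ (EuclideanSpace ℝ (Fin d)) = d := by simp
  set s : ℝ := d * p / q with hs
  have hs0 : 0 ≤ s := by positivity
  have hsd : s < d := by
    rw [hs, div_lt_iff₀ hq0]
    gcongr
  have hfp : ∀ y, |f y| ^ p = ‖y‖ ^ (-s) := fun y => by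
    rw [hf, abs_of_nonneg (by positivity), ← Real.rpow_mul (norm_nonneg y), hs]
    congr 1
    ring
  have hV0 : volume (Metric.ball (0 : EuclideanSpace ℝ (Fin d)) 1) ≠ 0 :=
    (Metric.measure_ball_pos _ _ one_pos).ne'
  have hVtop : volume (Metric.ball (0 : EuclideanSpace ℝ (Fin d)) 1) ≠ ∞ := measure_ball_lt_top.ne
  have hItop := setLIntegral_unitBall_norm_rpow_ne_top
    (volume : Measure (EuclideanSpace ℝ (Fin d))) (by rwa [hdim]) (s := s) (by rwa [hdim])
  unfold morreyNorm
  simp_rw [hfp]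
  constructor
  · refine ne_top_of_le_ne_top (ENNReal.mul_ne_top
      (ENNReal.rpow_ne_top_of_ne_zero hV0 hVtop (y := 1 / q - 1 / p))
      (ENNReal.rpow_ne_top_of_nonneg (y := 1 / p) (by positivity)
        (ENNReal.add_ne_top.2 ⟨hItop, hVtop⟩))) (iSup_le fun a => iSup₂_le fun r hr => ?_)
    have hle := setLIntegral_ball_norm_rpow_le volume hs0 a hr
    have hscale : ENNReal.ofReal (r ^ d) ^ (1 / q - 1 / p) *
        ENNReal.ofReal (r ^ ((d : ℝ) - s)) ^ (1 / p) = 1 := by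
      rw [← Real.rpow_natCast, ENNReal.ofReal_rpow_of_pos (by positivity),
        ENNReal.ofReal_rpow_of_pos (by positivity), ← ENNReal.ofReal_mul (by positivity),
        ← Real.rpow_mul hr.le, ← Real.rpow_mul hr.le, ← Real.rpow_add hr]
      have : (d : ℝ) * (1 / q - 1 / p) + (d - s) * (1 / p) = 0 := by
        rw [hs]
        field_simp
        ring
      rw [this, Real.rpow_zero, ENNReal.ofReal_one]
    rw [hdim] at hle
    refine (mul_le_mul_right (ENNReal.rpow_le_rpow hle (by positivity)) _).trans_eq ?_
    rw [Measure.addHaar_ball_of_pos volume a hr, hdim,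
      ENNReal.mul_rpow_of_ne_top ENNReal.ofReal_ne_top hVtop,
      ENNReal.mul_rpow_of_nonneg _ _ (by positivity), mul_mul_mul_comm, hscale, one_mul]
  · have hpos : 0 < ∫⁻ y in Metric.ball (0 : EuclideanSpace ℝ (Fin d)) 1,
        ENNReal.ofReal (‖y‖ ^ (-s)) := by
      refine hV0.bot_lt.trans_le ?_
      rw [← setLIntegral_one]
      have : Nontrivial (EuclideanSpace ℝ (Fin d)) :=
        Module.nontrivial_of_finrank_pos (R := ℝ) (by rwa [hdim])
      refine setLIntegral_mono_ae (by fun_prop) ?_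
      filter_upwards [compl_mem_ae_iff.2 (measure_singleton (0 : EuclideanSpace ℝ (Fin d)))]
        with y hy hyb
      rw [ENNReal.one_le_ofReal]
      exact Real.one_le_rpow_of_pos_of_le_one_of_nonpos (norm_pos_iff.2 hy)
        (mem_ball_zero_iff.1 hyb).le (by linarith)
    refine ne_of_gt (lt_of_lt_of_le ?_ (le_iSup_of_le 0 (le_iSup₂_of_le 1 one_pos le_rfl)))
    exact ENNReal.mul_pos (ENNReal.rpow_pos hV0.bot_lt hVtop).ne'
      (ENNReal.rpow_pos hpos hItop).ne'
end

section
/- Let 1 ≤ p < q < ∞ and d ≥ 1. Define f(x) := |x|^{−d/q}, g(x) := χ_{(0,1)}(|x|) f(x), h(x) := f(x) − g(x), and k(x) := −f(x) + 2g(x) for x ∈ ℝ^d. Then ‖f‖_{M^p_q} = ‖g‖_{M^p_q} = ‖h‖_{M^p_q} = ‖k‖_{M^p_q}, and this common value lies in (0, ∞). -/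
open MeasureTheory
open scoped ENNReal

open Metric in
theorem setLIntegral_ball_comp_smul {E : Type*} [NormedAddCommGroup E] [NormedSpace ℝ E]
    [FiniteDimensional ℝ E] [MeasurableSpace E] [BorelSpace E] (μ : Measure E)
    [μ.IsAddHaarMeasure] {t : ℝ} (ht : 0 < t) (a : E) (r : ℝ) {G : E → ℝ≥0∞}
    (hG : Measurable G) :
    ∫⁻ y in ball (t • a) (t * r), G y ∂μ =
      ENNReal.ofReal (t ^ Module.finrank ℝ E) * ∫⁻ x in ball a r, G (t • x) ∂μ := by
  have hpre : (t • · : E → E) ⁻¹' ball (t • a) (t * r) = ball a r := by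
    ext x
    simp only [Set.mem_preimage, mem_ball, dist_smul₀, Real.norm_eq_abs, abs_of_pos ht]
    exact mul_lt_mul_iff_right₀ ht
  have htd : 0 < t ^ Module.finrank ℝ E := pow_pos ht _
  rw [← hpre, ← setLIntegral_map measurableSet_ball hG (measurable_const_smul t),
    Measure.map_addHaar_smul μ ht.ne', Measure.restrict_smul, lintegral_smul_measure,
    smul_eq_mul, ← mul_assoc, ← ENNReal.ofReal_mul htd.le, abs_of_pos (inv_pos.2 htd),
    mul_inv_cancel₀ htd.ne', ENNReal.ofReal_one, one_mul]

/-- The quantity attached to the ball `B(a,r)` in the definition of the Morrey norm. -/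
noncomputable def morreyTerm (p q : ℝ) {d : ℕ} (f : EuclideanSpace ℝ (Fin d) → ℝ)
    (a : EuclideanSpace ℝ (Fin d)) (r : ℝ) : ℝ≥0∞ :=
  volume (Metric.ball a r) ^ ((1:ℝ)/q - 1/p) *
    (∫⁻ y in Metric.ball a r, ENNReal.ofReal (|f y| ^ p)) ^ ((1:ℝ)/p)

section

variable {p q : ℝ} {d : ℕ} {F G : EuclideanSpace ℝ (Fin d) → ℝ}

theorem morreyTerm_le_morreyNorm (a : EuclideanSpace ℝ (Fin d)) {r : ℝ} (hr : 0 < r) :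
    morreyTerm p q F a r ≤ morreyNorm p q d F :=
  le_iSup₂_of_le a r (le_iSup_of_le hr le_rfl)

theorem morreyNorm_le {C : ℝ≥0∞} (h : ∀ a r, 0 < r → morreyTerm p q F a r ≤ C) :
    morreyNorm p q d F ≤ C :=
  iSup₂_le fun a r => iSup_le fun hr => h a r hr

theorem morreyNorm_mono (hp : 0 ≤ p) (h : ∀ x, |F x| ≤ |G x|) :
    morreyNorm p q d F ≤ morreyNorm p q d G := by
  refine morreyNorm_le fun a r hr => le_trans ?_ (morreyTerm_le_morreyNorm a hr)
  refine mul_le_mul_right (ENNReal.rpow_le_rpow (lintegral_mono fun x => ?_) (by positivity)) _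
  exact ENNReal.ofReal_le_ofReal (Real.rpow_le_rpow (abs_nonneg _) (h x) hp)

/-- Functions that agree up to the scaling `x ↦ t x` have the same Morrey quantities on the
correspondingly scaled balls. -/
theorem morreyTerm_smul (hp : 0 < p) (hF : Measurable F) {t : ℝ} (ht : 0 < t)
    {a : EuclideanSpace ℝ (Fin d)} {r : ℝ}
    (h : ∀ x ∈ Metric.ball a r, F (t • x) = t ^ (-(d : ℝ) / q) * G x) :
    morreyTerm p q F (t • a) (t * r) = morreyTerm p q G a r := by
  have hvol : volume (Metric.ball (t • a) (t * r)) =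
      ENNReal.ofReal t ^ (d : ℝ) * volume (Metric.ball a r) := by
    have := setLIntegral_ball_comp_smul (volume : Measure (EuclideanSpace ℝ (Fin d))) ht a r
      (G := fun _ => 1) measurable_const
    simpa [ENNReal.ofReal_pow ht.le] using this
  have hint : ∫⁻ y in Metric.ball (t • a) (t * r), ENNReal.ofReal (|F y| ^ p) =
      ENNReal.ofReal t ^ ((d : ℝ) - d / q * p) *
        ∫⁻ y in Metric.ball a r, ENNReal.ofReal (|G y| ^ p) := by
    rw [setLIntegral_ball_comp_smul volume ht a r (by fun_prop),
      setLIntegral_congr_fun (g := fun x => ENNReal.ofReal t ^ (-(d : ℝ) / q * p) *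
        ENNReal.ofReal (|G x| ^ p)) measurableSet_ball, lintegral_const_mul', ← mul_assoc]
    · congr 1
      rw [finrank_euclideanSpace_fin, ENNReal.ofReal_pow ht.le, ← ENNReal.rpow_natCast,
        ← ENNReal.rpow_add _ _ (by simpa using ht) ENNReal.ofReal_ne_top]
      congr 1
      ring
    · exact ENNReal.rpow_ne_top_of_ne_zero (by simpa using ht) ENNReal.ofReal_ne_top
    · intro x hx
      simp only
      rw [h x hx, abs_mul, Real.mul_rpow (abs_nonneg _) (abs_nonneg _),
        abs_of_pos (Real.rpow_pos_of_pos ht _), ← Real.rpow_mul ht.le,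
        ENNReal.ofReal_mul (by positivity), ENNReal.ofReal_rpow_of_pos ht]
  have h0 : ENNReal.ofReal t ≠ 0 := by simpa using ht
  have h1 : ENNReal.ofReal t ≠ ∞ := ENNReal.ofReal_ne_top
  have hT : ENNReal.ofReal t ^ ((d : ℝ) * (1 / q - 1 / p)) *
      ENNReal.ofReal t ^ (((d : ℝ) - d / q * p) * (1 / p)) = 1 := by
    rw [← ENNReal.rpow_add _ _ h0 h1]
    convert ENNReal.rpow_zero
    field_simp
    ring
  unfold morreyTerm
  rw [hvol, hint, ENNReal.mul_rpow_of_ne_top (ENNReal.rpow_ne_top_of_ne_zero h0 h1) measure_ball_lt_top.ne,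
    ENNReal.mul_rpow_of_nonneg _ _ (by positivity), ← ENNReal.rpow_mul, ← ENNReal.rpow_mul,
    mul_mul_mul_comm, hT, one_mul]

/-- The Morrey quantity on a ball is the supremum of those of the truncations away from the
origin. -/
theorem morreyTerm_le_iSup_truncate (hp : 0 < p) (hF : Measurable F) (hF0 : F 0 = 0)
    (a : EuclideanSpace ℝ (Fin d)) (r : ℝ) :
    morreyTerm p q F a r ≤ ⨆ n : ℕ,
      morreyTerm p q (fun x => if 1 ≤ ((n : ℝ) + 1) * ‖x‖ then F x else 0) a r := by
  have hpt : ∀ x, ENNReal.ofReal (|F x| ^ p) ≤ ⨆ n : ℕ,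
      ENNReal.ofReal (|if 1 ≤ ((n : ℝ) + 1) * ‖x‖ then F x else 0| ^ p) := by
    intro x
    rcases eq_or_ne x 0 with rfl | hx
    · simp [hF0, hp.ne']
    · have hx' : 0 < ‖x‖ := norm_pos_iff.2 hx
      obtain ⟨n, hn⟩ := exists_nat_ge (1 / ‖x‖)
      rw [div_le_iff₀ hx'] at hn
      refine le_iSup_of_le n ?_
      rw [if_pos (by nlinarith)]
  have hmeas : ∀ n : ℕ, Measurable fun x =>
      ENNReal.ofReal (|if 1 ≤ ((n : ℝ) + 1) * ‖x‖ then F x else 0| ^ p) := by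
    intro n
    have : Measurable fun x => if 1 ≤ ((n : ℝ) + 1) * ‖x‖ then F x else 0 :=
      Measurable.ite (measurableSet_le (by fun_prop) (by fun_prop)) hF measurable_const
    fun_prop
  have hmono : Monotone fun (n : ℕ) x =>
      ENNReal.ofReal (|if 1 ≤ ((n : ℝ) + 1) * ‖x‖ then F x else 0| ^ p) := by
    intro m n hmn x
    refine ENNReal.ofReal_le_ofReal (Real.rpow_le_rpow (abs_nonneg _) ?_ hp.le)
    by_cases hm : 1 ≤ ((m : ℝ) + 1) * ‖x‖
    · have hmn' : (m : ℝ) ≤ n := by exact_mod_cast hmn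
      have hn : 1 ≤ ((n : ℝ) + 1) * ‖x‖ := hm.trans (by gcongr)
      rw [if_pos hm, if_pos hn]
    · rw [if_neg hm, abs_zero]
      positivity
  have hint := lintegral_mono (μ := volume.restrict (Metric.ball a r)) hpt
  rw [lintegral_iSup hmeas hmono] at hint
  unfold morreyTerm
  rw [← ENNReal.mul_iSup]
  refine mul_le_mul_right ((ENNReal.rpow_le_rpow hint (by positivity)).trans_eq ?_) _
  exact (ENNReal.orderIsoRpow (1 / p) (by positivity)).map_iSup _

theorem lintegral_ball_norm_rpow_lt_top (hd : 1 ≤ d) (hp : 0 < p) (hpq : p < q) :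
    ∫⁻ x in Metric.ball (0 : EuclideanSpace ℝ (Fin d)) 1,
      ENNReal.ofReal (|‖x‖ ^ (-(d : ℝ) / q)| ^ p) < ∞ := by
  have hq : 0 < q := hp.trans hpq
  have hd' : (0 : ℝ) < d := by exact_mod_cast hd
  have : IntegrableOn (fun x : EuclideanSpace ℝ (Fin d) => |‖x‖ ^ (-(d : ℝ) / q)| ^ p)
      (Metric.ball 0 1) volume := by
    refine integrableOn_ball_of_norm_le_rpow (C := 1) (α := d / q * p) (by simpa using hd) ?_ ?_ ?_
    · rw [finrank_euclideanSpace_fin, div_mul_eq_mul_div, div_lt_iff₀ hq]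
      gcongr
    · refine Filter.Eventually.of_forall fun x => ?_
      rw [abs_of_nonneg (by positivity), ← Real.rpow_mul (norm_nonneg _),
        Real.norm_of_nonneg (by positivity), one_mul, neg_div, neg_mul]
    · exact Measurable.aestronglyMeasurable (by fun_prop)
  exact this.lintegral_lt_top

theorem morreyNorm_norm_rpow_lt_top (hd : 1 ≤ d) (hp : 0 < p) (hpq : p < q) :
    morreyNorm p q d (fun x => ‖x‖ ^ (-(d : ℝ) / q)) < ∞ := by
  have hq : 0 < q := hp.trans hpq
  set V := volume (Metric.ball (0 : EuclideanSpace ℝ (Fin d)) 1) with hV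
  have hV0 : V ≠ 0 := (Metric.measure_ball_pos _ _ one_pos).ne'
  have hVt : V ≠ ∞ := measure_ball_lt_top.ne
  set I := ∫⁻ x in Metric.ball (0 : EuclideanSpace ℝ (Fin d)) 1,
      ENNReal.ofReal (|‖x‖ ^ (-(d : ℝ) / q)| ^ p)
  have hI : I < ∞ := lintegral_ball_norm_rpow_lt_top hd hp hpq
  have hC : V ^ ((1:ℝ)/q - 1/p) * (I + V) ^ ((1:ℝ)/p) < ∞ :=
    ENNReal.mul_lt_top (ENNReal.rpow_ne_top_of_ne_zero hV0 hVt).lt_top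
      (ENNReal.rpow_lt_top_of_nonneg (by positivity) (ENNReal.add_ne_top.2 ⟨hI.ne, hVt⟩))
  refine lt_of_le_of_lt (morreyNorm_le fun a r hr => ?_) hC
  have hs := morreyTerm_smul (p := p) (q := q) (d := d) (F := fun x => ‖x‖ ^ (-(d : ℝ) / q))
    (G := fun x => ‖x‖ ^ (-(d : ℝ) / q)) hp (by fun_prop) hr (a := r⁻¹ • a) (r := 1)
    (fun x _ => by
      rw [norm_smul, Real.norm_of_nonneg hr.le, Real.mul_rpow hr.le (norm_nonneg _)])
  rw [smul_inv_smul₀ hr.ne', mul_one] at hs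
  rw [hs]
  unfold morreyTerm
  rw [Measure.addHaar_ball_center]
  refine mul_le_mul_right (ENNReal.rpow_le_rpow ?_ (by positivity)) _
  set b := r⁻¹ • a
  calc ∫⁻ x in Metric.ball b 1, ENNReal.ofReal (|‖x‖ ^ (-(d : ℝ) / q)| ^ p)
      ≤ ∫⁻ x in Metric.ball b 1, ((Metric.ball 0 1).indicator
          (fun x => ENNReal.ofReal (|‖x‖ ^ (-(d : ℝ) / q)| ^ p)) x + 1) := by
        refine lintegral_mono fun x => ?_
        by_cases hx : x ∈ Metric.ball (0 : EuclideanSpace ℝ (Fin d)) 1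
        · simp only [Set.indicator_of_mem hx]
          exact le_self_add
        · simp only [Set.indicator_of_notMem hx, zero_add]
          rw [mem_ball_zero_iff, not_lt] at hx
          rw [ENNReal.ofReal_le_one]
          refine Real.rpow_le_one (abs_nonneg _) ?_ hp.le
          rw [abs_of_nonneg (by positivity)]
          exact Real.rpow_le_one_of_one_le_of_nonpos hx
            (div_nonpos_of_nonpos_of_nonneg (by simp) hq.le)
    _ ≤ I + V := by
        rw [lintegral_add_right _ measurable_const]
        gcongr
        · exact (setLIntegral_le_lintegral _ _).trans_eq
            (lintegral_indicator measurableSet_ball _)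
        · simp [hV, Measure.addHaar_ball_center]

theorem morreyNorm_pos (hd : 1 ≤ d) (hp : 0 < p) (hF : Measurable F)
    (hF0 : ∀ x, x ≠ 0 → F x ≠ 0) : 0 < morreyNorm p q d F := by
  have : Nonempty (Fin d) := ⟨⟨0, hd⟩⟩
  refine lt_of_lt_of_le ?_ (morreyTerm_le_morreyNorm 0 one_pos)
  have hpos : 0 < ∫⁻ y in Metric.ball (0 : EuclideanSpace ℝ (Fin d)) 1,
      ENNReal.ofReal (|F y| ^ p) := by
    rw [setLIntegral_pos_iff (by fun_prop)]
    have hsub : Metric.ball (0 : EuclideanSpace ℝ (Fin d)) 1 \ {0} ⊆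
        Function.support (fun y => ENNReal.ofReal (|F y| ^ p)) ∩ Metric.ball 0 1 := by
      rintro x ⟨hx, hx0⟩
      refine ⟨?_, hx⟩
      have : 0 < |F x| := abs_pos.2 (hF0 x hx0)
      exact (ENNReal.ofReal_pos.2 (Real.rpow_pos_of_pos this p)).ne'
    refine lt_of_lt_of_le ?_ (measure_mono hsub)
    rw [measure_sdiff_null (measure_singleton _)]
    exact Metric.measure_ball_pos _ _ one_pos
  refine ENNReal.mul_pos ?_ ?_
  · exact (ENNReal.rpow_pos (Metric.measure_ball_pos _ _ one_pos) measure_ball_lt_top.ne).ne'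
  · exact (ENNReal.rpow_pos_of_nonneg hpos (by positivity)).ne'

end

/-- For `1 ≤ p < q < ∞`, `d ≥ 1`, `f(x) = |x|^(-d/q)`, `g = χ_(0,1)(|x|) f`, `h = f - g`,
`k = -f + 2g`, the Morrey norms of `f, g, h, k` coincide and the common value is in `(0, ∞)`. -/
theorem morreyNorm_fghk_eq (p q : ℝ) (d : ℕ) (hp : 1 ≤ p) (hpq : p < q) (hd : 1 ≤ d)
    (f g h k : EuclideanSpace ℝ (Fin d) → ℝ)
    (hf : f = fun x => ‖x‖ ^ (-(d : ℝ) / q))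
    (hg : g = fun x => if 0 < ‖x‖ ∧ ‖x‖ < 1 then f x else 0)
    (hh : h = f - g) (hk : k = -f + (2 : ℝ) • g) :
    morreyNorm p q d f = morreyNorm p q d g ∧
    morreyNorm p q d f = morreyNorm p q d h ∧
    morreyNorm p q d f = morreyNorm p q d k ∧
    morreyNorm p q d f ≠ 0 ∧ morreyNorm p q d f ≠ ∞ := by
  have hp0 : 0 < p := by linarith
  have hq0 : 0 < q := by linarith
  have hd0 : (0 : ℝ) < d := by exact_mod_cast hd
  have hexp : -(d : ℝ) / q ≠ 0 := (div_neg_of_neg_of_pos (by linarith) hq0).ne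
  have hfm : Measurable f := by rw [hf]; fun_prop
  have hf0 : f 0 = 0 := by simp [hf, Real.zero_rpow hexp]
  have hfs : ∀ {t : ℝ}, 0 < t → ∀ x, f (t • x) = t ^ (-(d : ℝ) / q) * f x := fun ht x => by
    simp only [hf]
    rw [norm_smul, Real.norm_of_nonneg ht.le, Real.mul_rpow ht.le (norm_nonneg _)]
  have hg' : ∀ x, g x = if ‖x‖ < 1 then f x else 0 := by
    intro x
    rcases eq_or_ne x 0 with rfl | hx
    · simp [hg, hf0]
    · simp [hg, hx]
  have hh' : ∀ x, h x = if 1 ≤ ‖x‖ then f x else 0 := by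
    intro x
    rw [hh, Pi.sub_apply, hg']
    split_ifs <;> linarith
  have hgm : Measurable g := by
    rw [funext hg']
    exact Measurable.ite (measurableSet_lt (by fun_prop) (by fun_prop)) hfm measurable_const
  have hhm : Measurable h := hh ▸ hfm.sub hgm
  have hkf : ∀ x, |k x| = |f x| := by
    intro x
    simp only [hk, Pi.add_apply, Pi.neg_apply, Pi.smul_apply, hg', smul_eq_mul]
    split_ifs
    · congr 1
      ring
    · simp
  refine ⟨le_antisymm ?_ ?_, le_antisymm ?_ ?_, le_antisymm ?_ ?_, ?_, ?_⟩
  · refine morreyNorm_le fun a r hr => ?_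
    have ht : 0 < (‖a‖ + r)⁻¹ := by positivity
    rw [← morreyTerm_smul hp0 hgm ht (F := g) (G := f)]
    · exact morreyTerm_le_morreyNorm _ (by positivity)
    · intro x hx
      rw [hg', if_pos, hfs ht]
      have hxn : ‖x‖ < ‖a‖ + r := by
        have := norm_le_norm_add_norm_sub a x
        rw [mem_ball_iff_norm] at hx
        rw [norm_sub_rev] at this
        linarith
      rw [norm_smul, Real.norm_of_nonneg ht.le, inv_mul_lt_one₀ (by positivity)]
      exact hxn
  · refine morreyNorm_mono hp0.le fun x => ?_
    rw [hg']
    split_ifs <;> simp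
  · refine morreyNorm_le fun a r hr => ?_
    refine (morreyTerm_le_iSup_truncate hp0 hfm hf0 a r).trans (iSup_le fun n => ?_)
    have ht : 0 < (n : ℝ) + 1 := by positivity
    rw [← morreyTerm_smul hp0 hhm ht (F := h)]
    · exact morreyTerm_le_morreyNorm _ (by positivity)
    · intro x _
      rw [hh', hfs ht, norm_smul, Real.norm_of_nonneg ht.le]
      split_ifs <;> simp
  · refine morreyNorm_mono hp0.le fun x => ?_
    rw [hh']
    split_ifs <;> simp
  · exact morreyNorm_mono hp0.le fun x => (hkf x).ge
  · exact morreyNorm_mono hp0.le fun x => (hkf x).le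
  · refine (morreyNorm_pos hd hp0 hfm fun x hx => ?_).ne'
    simp only [hf]
    exact (Real.rpow_pos_of_pos (norm_pos_iff.2 hx) _).ne'
  · rw [hf]
    exact (morreyNorm_norm_rpow_lt_top hd hp0 hpq).ne
end
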